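/- arXiv:2405.14164 — 10 statements merged into one kernel-verified Lean document; each statement's English description precedes it below -/
import Mathlib

section
/- Let 0 < ρ_s < ρ_b and H_s, H_b > 0. There exist two real numbers 0 < Fr₋ < Fr₊ such that for all U_s, U_b ∈ ℝ: (1) if |U_b − U_s| < √H_b·Fr₋, then the matrix A = A(H_s, H_b, U_s, U_b) has four distinct real eigenvalues; (2) if √H_b·Fr₋ < |U_b − U_s| < √H_b·Fr₊, then A has exactly two distinct real eigenvalues and two distinct non-real complex conjugate eigenvalues; (3) if |U_b − U_s| > √H_b·Fr₊, then A has four distinct real eigenvalues. -/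
/-- The characteristic polynomial (over `ℂ`) of the coefficient matrix
`A = [[U_s, 0, H_s, 0], [0, U_b, 0, H_b], [1, 1, U_s, 0], [γ, 1, 0, U_b]]`
of the bilayer shallow water system, with `γ = ρ_s/ρ_b`. -/
noncomputable def bilayerCharPoly (ρs ρb Hs Hb Us Ub : ℝ) (z : ℂ) : ℂ :=
  (((Ub : ℂ) - z) ^ 2 - (Hb : ℂ)) * (((Us : ℂ) - z) ^ 2 - (Hs : ℂ))
    - ((ρs / ρb : ℝ) : ℂ) * (Hs : ℂ) * (Hb : ℂ)

/-- The characteristic polynomial of the bilayer system in the frame moving with the upper layer: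
`a ^ 2`, `b ^ 2` are the layer heights, `d` the velocity shift and `c` the coupling. -/
def shiftedQuartic {R : Type*} [CommRing R] (a b c d y : R) : R :=
  ((y - d) ^ 2 - a ^ 2) * (y ^ 2 - b ^ 2) - c

lemma continuous_shiftedQuartic (a b c d : ℝ) : Continuous (shiftedQuartic a b c d) := by
  unfold shiftedQuartic
  fun_prop

lemma exists_injective_roots_of_alternating {F : ℝ → ℝ} (hF : Continuous F) {x₀ x₁ x₂ x₃ x₄ : ℝ}
    (h₀₁ : x₀ < x₁) (h₁₂ : x₁ < x₂) (h₂₃ : x₂ < x₃) (h₃₄ : x₃ < x₄)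
    (h₀ : 0 < F x₀) (h₁ : F x₁ < 0) (h₂ : 0 < F x₂) (h₃ : F x₃ < 0) (h₄ : 0 < F x₄) :
    ∃ l : Fin 4 → ℝ, Function.Injective l ∧ ∀ i, F (l i) = 0 := by
  obtain ⟨r₀, ⟨_, _⟩, hr₀⟩ := intermediate_value_Ioo' h₀₁.le hF.continuousOn ⟨h₁, h₀⟩
  obtain ⟨r₁, ⟨_, _⟩, hr₁⟩ := intermediate_value_Ioo h₁₂.le hF.continuousOn ⟨h₁, h₂⟩
  obtain ⟨r₂, ⟨_, _⟩, hr₂⟩ := intermediate_value_Ioo' h₂₃.le hF.continuousOn ⟨h₃, h₂⟩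
  obtain ⟨r₃, ⟨_, _⟩, hr₃⟩ := intermediate_value_Ioo h₃₄.le hF.continuousOn ⟨h₃, h₄⟩
  refine ⟨![r₀, r₁, r₂, r₃], StrictMono.injective (Fin.strictMono_iff_lt_succ.2 ?_), ?_⟩
  · intro i
    fin_cases i
    · change r₀ < r₁; linarith
    · change r₁ < r₂; linarith
    · change r₂ < r₃; linarith
  · intro i
    fin_cases i <;> assumption

section

variable {a b c d : ℝ}

lemma shiftedQuartic_pos_right (ha : 0 < a) (hb : 0 < b) (hc : c < a ^ 2 * b ^ 2) (hd : 0 ≤ d) :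
    0 < shiftedQuartic a b c d (d + a + b) := by
  have hab := mul_pos ha hb
  have h₁ : b ^ 2 ≤ (d + a + b - d) ^ 2 - a ^ 2 := by nlinarith
  have h₂ : a ^ 2 ≤ (d + a + b) ^ 2 - b ^ 2 := by
    nlinarith [mul_nonneg hd ha.le, mul_nonneg hd hb.le]
  have := mul_le_mul h₁ h₂ (sq_nonneg a) ((sq_nonneg b).trans h₁)
  unfold shiftedQuartic
  linarith

lemma shiftedQuartic_pos_left (ha : 0 < a) (hb : 0 < b) (hc : c < a ^ 2 * b ^ 2) (hd : 0 ≤ d) :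
    0 < shiftedQuartic a b c d (-(a + b)) := by
  have hab := mul_pos ha hb
  have h₁ : b ^ 2 ≤ (-(a + b) - d) ^ 2 - a ^ 2 := by
    nlinarith [mul_nonneg hd ha.le, mul_nonneg hd hb.le]
  have h₂ : a ^ 2 ≤ (-(a + b)) ^ 2 - b ^ 2 := by nlinarith
  have := mul_le_mul h₁ h₂ (sq_nonneg a) ((sq_nonneg b).trans h₁)
  unfold shiftedQuartic
  linarith

lemma shiftedQuartic_neg_of_mem {y : ℝ} (hc : 0 < c) (hy : y = b ∨ y = -b ∨ y = d + a ∨ y = d - a) :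
    shiftedQuartic a b c d y < 0 := by
  unfold shiftedQuartic
  rcases hy with rfl | rfl | rfl | rfl <;> ring_nf <;> linarith

/-- The line at shift `d` meets the convex side of the bounded oval of the characteristic curve. -/
def MeetsOval (a b c d : ℝ) : Prop :=
  ∃ y, |y| < b ∧ |y - d| < a ∧ 0 ≤ shiftedQuartic a b c d y

/-- The line at shift `d` meets the convex side of the fourth-quadrant branch of the
characteristic curve. -/
def MeetsBranch (a b c d : ℝ) : Prop :=
  ∃ y, b < y ∧ y < d - a ∧ 0 ≤ shiftedQuartic a b c d y

lemma MeetsOval.exists_pos_of_lt {e : ℝ} (h : MeetsOval a b c e) (hd : 0 ≤ d) (hde : d < e) :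
    ∃ y, |y| < b ∧ |y - d| < a ∧ 0 < shiftedQuartic a b c d y := by
  obtain ⟨y, hyb, hya, hy⟩ := h
  have he : 0 < e := hd.trans_lt hde
  obtain ⟨t, ht₀, ht₁, rfl⟩ : ∃ t, 0 ≤ t ∧ t < 1 ∧ d = t * e :=
    ⟨d / e, by positivity, (div_lt_one he).2 hde, by field_simp⟩
  have hsub : t * y - t * e = t * (y - e) := by ring
  refine ⟨t * y, ?_, ?_, ?_⟩
  · rw [abs_mul, abs_of_nonneg ht₀]; nlinarith [abs_nonneg y]
  · rw [hsub, abs_mul, abs_of_nonneg ht₀]; nlinarith [abs_nonneg (y - e)]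
  have hp : 0 < a ^ 2 - (y - e) ^ 2 := sub_pos.2 (sq_lt_sq.2 (hya.trans_le (le_abs_self a)))
  have hq : 0 < b ^ 2 - y ^ 2 := sub_pos.2 (sq_lt_sq.2 (hyb.trans_le (le_abs_self b)))
  have hs : 0 < 1 - t ^ 2 := by nlinarith
  have hne : 0 < (y - e) ^ 2 ∨ 0 < y ^ 2 := by
    rcases eq_or_ne y 0 with rfl | h
    · left; simpa using pow_pos he 2
    · right; positivity
  unfold shiftedQuartic at *
  rw [hsub]
  have key : ((t * (y - e)) ^ 2 - a ^ 2) * ((t * y) ^ 2 - b ^ 2) - c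
      = (((y - e) ^ 2 - a ^ 2) * (y ^ 2 - b ^ 2) - c)
        + ((1 - t ^ 2) * ((y - e) ^ 2 * (b ^ 2 - y ^ 2) + y ^ 2 * (a ^ 2 - (y - e) ^ 2))
        + (1 - t ^ 2) ^ 2 * ((y - e) ^ 2 * y ^ 2)) := by ring
  rw [key]
  rcases hne with h | h <;> positivity

lemma MeetsBranch.exists_pos_of_gt {e : ℝ} (ha : 0 < a) (hb : 0 < b) (h : MeetsBranch a b c e)
    (hde : e < d) :
    ∃ y, b < y ∧ y < d - a ∧ 0 < shiftedQuartic a b c d y := by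
  obtain ⟨y, hyb, hya, hy⟩ := h
  have he : 0 < e := by linarith
  obtain ⟨t, ht, rfl⟩ : ∃ t, 1 < t ∧ d = t * e :=
    ⟨d / e, (one_lt_div he).2 hde, by field_simp⟩
  have hsub : t * y - t * e = t * (y - e) := by ring
  refine ⟨t * y, by nlinarith, by nlinarith, ?_⟩
  have hp : 0 < (y - e) ^ 2 - a ^ 2 := by nlinarith
  have hq : 0 < y ^ 2 - b ^ 2 := by nlinarith
  have hs : 0 < t ^ 2 - 1 := by nlinarith
  have hy₀ : 0 < y := hb.trans hyb
  unfold shiftedQuartic at *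
  rw [hsub]
  have key : ((t * (y - e)) ^ 2 - a ^ 2) * ((t * y) ^ 2 - b ^ 2) - c
      = (((y - e) ^ 2 - a ^ 2) * (y ^ 2 - b ^ 2) - c)
        + ((t ^ 2 - 1) * ((y - e) ^ 2 * (y ^ 2 - b ^ 2) + y ^ 2 * ((y - e) ^ 2 - a ^ 2))
        + (t ^ 2 - 1) ^ 2 * ((y - e) ^ 2 * y ^ 2)) := by ring
  rw [key]
  positivity

lemma MeetsOval.le (ha : 0 < a) (hb : 0 < b) (h : MeetsOval a b c d) :
    d ≤ a + b - c / (2 * a * b ^ 2) := by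
  obtain ⟨y, hyb, hya, hy⟩ := h
  have hy' := abs_lt.1 hya
  have hq : 0 < b ^ 2 - y ^ 2 := sub_pos.2 (sq_lt_sq.2 (hyb.trans_le (le_abs_self b)))
  have hc : c ≤ (a + (y - d)) * (2 * a * b ^ 2) := by
    unfold shiftedQuartic at hy
    have h₁ : a ^ 2 - (y - d) ^ 2 ≤ (a + (y - d)) * (2 * a) := by nlinarith
    have h₂ : (a ^ 2 - (y - d) ^ 2) * (b ^ 2 - y ^ 2) ≤ ((a + (y - d)) * (2 * a)) * b ^ 2 :=
      mul_le_mul h₁ (by linarith [sq_nonneg y]) hq.le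
        (mul_nonneg (by linarith) (by linarith))
    linarith
  have := (div_le_iff₀ (by positivity : 0 < 2 * a * b ^ 2)).2 hc
  linarith [(abs_lt.1 hyb).2]

lemma exists_meetsOval_pos (ha : 0 < a) (hb : 0 < b) (hc : c < a ^ 2 * b ^ 2) :
    ∃ d, 0 < d ∧ MeetsOval a b c d := by
  have hev : ∀ᶠ d in nhds (0 : ℝ), d < a ∧ 0 < shiftedQuartic a b c d 0 := by
    refine (eventually_lt_nhds ha).and ?_
    have : Continuous fun d ↦ shiftedQuartic a b c d 0 := by
      unfold shiftedQuartic
      fun_prop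
    exact this.continuousAt.eventually_const_lt (by unfold shiftedQuartic; nlinarith)
  obtain ⟨d, ⟨hda, hd⟩, hd₀⟩ :=
    ((hev.filter_mono nhdsWithin_le_nhds).and (self_mem_nhdsWithin (s := Set.Ioi 0))).exists
  have hd_pos : 0 < d := hd₀
  exact ⟨d, hd_pos, 0, by simpa, by simpa [abs_of_pos hd_pos], hd.le⟩

lemma exists_meetsBranch (ha : 0 < a) (hb : 0 < b) (hc : c < a ^ 2 * b ^ 2) :
    ∃ d, MeetsBranch a b c d := by
  refine ⟨2 * (a + b), a + b, by linarith, by linarith, ?_⟩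
  have hab := mul_pos ha hb
  have h₁ : b ^ 2 ≤ (a + b - 2 * (a + b)) ^ 2 - a ^ 2 := by nlinarith
  have h₂ : a ^ 2 ≤ (a + b) ^ 2 - b ^ 2 := by nlinarith
  have := mul_le_mul h₁ h₂ (sq_nonneg a) ((sq_nonneg b).trans h₁)
  unfold shiftedQuartic
  linarith

lemma exists_critical_shifts (ha : 0 < a) (hb : 0 < b) (hc₀ : 0 < c) (hc : c < a ^ 2 * b ^ 2) :
    ∃ m M : ℝ, 0 < m ∧ m < M ∧
      (∀ d, 0 ≤ d → d < m → ∃ y, |y| < b ∧ |y - d| < a ∧ 0 < shiftedQuartic a b c d y) ∧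
      (∀ d, m < d → ¬ MeetsOval a b c d) ∧
      (∀ d, d < M → ¬ MeetsBranch a b c d) ∧
      (∀ d, M < d → ∃ y, b < y ∧ y < d - a ∧ 0 < shiftedQuartic a b c d y) := by
  obtain ⟨e, he, hOe⟩ := exists_meetsOval_pos ha hb hc
  have hS : BddAbove {d | MeetsOval a b c d} := ⟨_, fun _ h ↦ h.le ha hb⟩
  have hT' : ∀ d ∈ {d | MeetsBranch a b c d}, a + b ≤ d := by
    rintro d ⟨y, h₁, h₂, -⟩
    linarith
  have hT : BddBelow {d | MeetsBranch a b c d} := ⟨_, hT'⟩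
  refine ⟨sSup {d | MeetsOval a b c d}, sInf {d | MeetsBranch a b c d},
    he.trans_le (le_csSup hS hOe), ?_, ?_, ?_, ?_, ?_⟩
  · have h₁ : sSup {d | MeetsOval a b c d} ≤ a + b - c / (2 * a * b ^ 2) :=
      csSup_le ⟨e, hOe⟩ fun _ h ↦ h.le ha hb
    have h₂ : a + b ≤ sInf {d | MeetsBranch a b c d} := le_csInf (exists_meetsBranch ha hb hc) hT'
    have h₃ : 0 < c / (2 * a * b ^ 2) := by positivity
    linarith
  · intro d hd hdm
    obtain ⟨x, hx, hdx⟩ := exists_lt_of_lt_csSup ⟨e, hOe⟩ hdm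
    exact hx.exists_pos_of_lt hd hdx
  · exact fun d hd h ↦ hd.not_ge (le_csSup hS h)
  · exact fun d hd h ↦ hd.not_ge (csInf_le hT h)
  · intro d hd
    obtain ⟨x, hx, hdx⟩ := exists_lt_of_csInf_lt (exists_meetsBranch ha hb hc) hd
    exact MeetsBranch.exists_pos_of_gt ha hb hx hdx

lemma exists_four_roots_of_oval (ha : 0 < a) (hb : 0 < b) (hc₀ : 0 < c) (hc : c < a ^ 2 * b ^ 2)
    (hd : 0 ≤ d) {y : ℝ} (hyb : |y| < b) (hya : |y - d| < a) (hy : 0 < shiftedQuartic a b c d y) :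
    ∃ l : Fin 4 → ℝ, Function.Injective l ∧ ∀ i, shiftedQuartic a b c d (l i) = 0 := by
  rw [abs_lt] at hyb hya
  refine exists_injective_roots_of_alternating (continuous_shiftedQuartic a b c d)
    (x₀ := -(a + b)) (x₁ := max (-b) (d - a)) (x₂ := y) (x₃ := min b (d + a)) (x₄ := d + a + b)
    (lt_max_of_lt_left (by linarith)) (max_lt (by linarith) (by linarith))
    (lt_min (by linarith) (by linarith)) (min_lt_of_right_lt (by linarith))
    (shiftedQuartic_pos_left ha hb hc hd) (shiftedQuartic_neg_of_mem hc₀ ?_) hy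
    (shiftedQuartic_neg_of_mem hc₀ ?_) (shiftedQuartic_pos_right ha hb hc hd)
  · rcases max_choice (-b) (d - a) with h | h <;> simp [h]
  · rcases min_choice b (d + a) with h | h <;> simp [h]

lemma exists_four_roots_of_branch (ha : 0 < a) (hb : 0 < b) (hc₀ : 0 < c)
    (hc : c < a ^ 2 * b ^ 2) (hd : 0 ≤ d) {y : ℝ} (hyb : b < y) (hya : y < d - a)
    (hy : 0 < shiftedQuartic a b c d y) :
    ∃ l : Fin 4 → ℝ, Function.Injective l ∧ ∀ i, shiftedQuartic a b c d (l i) = 0 :=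
  exists_injective_roots_of_alternating (continuous_shiftedQuartic a b c d)
    (by linarith) hyb hya (by linarith)
    (shiftedQuartic_pos_left ha hb hc hd) (shiftedQuartic_neg_of_mem hc₀ (by simp)) hy
    (shiftedQuartic_neg_of_mem hc₀ (by simp)) (shiftedQuartic_pos_right ha hb hc hd)

lemma strictMonoOn_shiftedQuartic (ha : 0 < a) (hb : 0 < b) :
    StrictMonoOn (shiftedQuartic a b c d) (Set.Ici (max b (d + a))) := by
  intro x hx y hy hxy
  obtain ⟨hxb, hxa⟩ := max_le_iff.1 (Set.mem_Ici.1 hx)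
  have h₁ : (x - d) ^ 2 - a ^ 2 < (y - d) ^ 2 - a ^ 2 := by nlinarith
  have h₂ : x ^ 2 - b ^ 2 < y ^ 2 - b ^ 2 := by nlinarith
  unfold shiftedQuartic
  have := mul_lt_mul'' h₁ h₂ (by nlinarith) (by nlinarith)
  linarith

lemma strictAntiOn_shiftedQuartic (ha : 0 < a) (hb : 0 < b) :
    StrictAntiOn (shiftedQuartic a b c d) (Set.Iic (min (-b) (d - a))) := by
  intro x hx y hy hxy
  obtain ⟨hyb, hya⟩ := le_min_iff.1 (Set.mem_Iic.1 hy)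
  have h₁ : (y - d) ^ 2 - a ^ 2 < (x - d) ^ 2 - a ^ 2 := by nlinarith
  have h₂ : y ^ 2 - b ^ 2 < x ^ 2 - b ^ 2 := by nlinarith
  unfold shiftedQuartic
  have := mul_lt_mul'' h₁ h₂ (by nlinarith) (by nlinarith)
  linarith

lemma mem_outer_of_shiftedQuartic_eq_zero (ha : 0 < a) (hb : 0 < b) (hc₀ : 0 < c) (hd : 0 < d)
    (hO : ¬ MeetsOval a b c d) (hB : ¬ MeetsBranch a b c d) {x : ℝ}
    (hx : shiftedQuartic a b c d x = 0) :
    (b < x ∧ d + a < x) ∨ (x < -b ∧ x < d - a) := by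
  have hprod : 0 < ((x - d) ^ 2 - a ^ 2) * (x ^ 2 - b ^ 2) := by
    unfold shiftedQuartic at hx
    linarith
  rcases mul_pos_iff.1 hprod with ⟨h₁, h₂⟩ | ⟨h₁, h₂⟩
  · have h₁' : a < |x - d| := lt_of_pow_lt_pow_left₀ 2 (abs_nonneg _) (by rw [sq_abs]; linarith)
    have h₂' : b < |x| := lt_of_pow_lt_pow_left₀ 2 (abs_nonneg _) (by rw [sq_abs]; linarith)
    rcases lt_abs.1 h₁' with h | h <;> rcases lt_abs.1 h₂' with h' | h'
    · exact Or.inl ⟨h', by linarith⟩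
    · linarith
    · exact absurd ⟨x, h', by linarith, hx.ge⟩ hB
    · exact Or.inr ⟨by linarith, by linarith⟩
  · exact absurd ⟨x, abs_lt_of_sq_lt_sq (by linarith) hb.le,
      abs_lt_of_sq_lt_sq (by linarith) ha.le, hx.ge⟩ hO

/-- Division of `shiftedQuartic` by `(y - l₁) * (y - l₂)`, with interpolating remainder. -/
lemma sub_mul_shiftedQuartic {R : Type*} [CommRing R] (a b c d l₁ l₂ y : R) :
    (l₁ - l₂) * shiftedQuartic a b c d y =
      shiftedQuartic a b c d l₁ * (y - l₂) - shiftedQuartic a b c d l₂ * (y - l₁) +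
      (l₁ - l₂) * ((y - l₁) * (y - l₂) * (y ^ 2 + (l₁ + l₂ - 2 * d) * y +
        (d ^ 2 - a ^ 2 - b ^ 2 + (l₁ + l₂) * (l₁ + l₂ - 2 * d) - l₁ * l₂))) := by
  unfold shiftedQuartic
  ring

lemma exists_nonreal_root_of_monic_quadratic {p q : ℝ} (h : ∀ x : ℝ, x ^ 2 + p * x + q ≠ 0) :
    ∃ z : ℂ, z.im ≠ 0 ∧ z ^ 2 + p * z + q = 0 := by
  have hdisc : 0 < 4 * q - p ^ 2 := by
    by_contra! hle
    refine h ((-p + √(p ^ 2 - 4 * q)) / 2) ?_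
    nlinarith [Real.sq_sqrt (show 0 ≤ p ^ 2 - 4 * q by linarith)]
  refine ⟨⟨-p / 2, √(4 * q - p ^ 2) / 2⟩, (by positivity), ?_⟩
  have hs := Real.sq_sqrt hdisc.le
  apply Complex.ext
  · simp only [pow_two] at hs ⊢
    simp
    linarith
  · simp [pow_two]
    ring

lemma exists_two_real_roots (ha : 0 < a) (hb : 0 < b) (hc₀ : 0 < c) (hc : c < a ^ 2 * b ^ 2)
    (hd : 0 < d) (hO : ¬ MeetsOval a b c d) (hB : ¬ MeetsBranch a b c d) :
    ∃ l₁ l₂ : ℝ, l₁ ≠ l₂ ∧ shiftedQuartic a b c d l₁ = 0 ∧ shiftedQuartic a b c d l₂ = 0 ∧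
      (∀ x, shiftedQuartic a b c d x = 0 → x = l₁ ∨ x = l₂) ∧
      ∃ z : ℂ, z.im ≠ 0 ∧ shiftedQuartic (a : ℂ) b c d z = 0 := by
  have hcont := continuous_shiftedQuartic a b c d
  obtain ⟨l₁, ⟨-, h₁⟩, hl₁⟩ := intermediate_value_Ioo' (a := -(a + b)) (b := min (-b) (d - a))
    (le_min (by linarith) (by linarith)) hcont.continuousOn
    ⟨shiftedQuartic_neg_of_mem hc₀ (by rcases min_choice (-b) (d - a) with h | h <;> simp [h]),
      shiftedQuartic_pos_left ha hb hc hd.le⟩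
  obtain ⟨l₂, ⟨h₂, -⟩, hl₂⟩ := intermediate_value_Ioo (a := max b (d + a)) (b := d + a + b)
    (max_le (by linarith) (by linarith)) hcont.continuousOn
    ⟨shiftedQuartic_neg_of_mem hc₀ (by rcases max_choice b (d + a) with h | h <;> simp [h]),
      shiftedQuartic_pos_right ha hb hc hd.le⟩
  obtain ⟨h₁b, h₁a⟩ := lt_min_iff.1 h₁
  obtain ⟨h₂b, h₂a⟩ := max_lt_iff.1 h₂
  have hlt : l₁ < l₂ := by linarith
  have huniq : ∀ x, shiftedQuartic a b c d x = 0 → x = l₁ ∨ x = l₂ := by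
    intro x hx
    rcases mem_outer_of_shiftedQuartic_eq_zero ha hb hc₀ hd hO hB hx with ⟨h, h'⟩ | ⟨h, h'⟩
    · exact Or.inr ((strictMonoOn_shiftedQuartic ha hb).injOn (max_lt h h').le h₂.le
        (hx.trans hl₂.symm))
    · exact Or.inl ((strictAntiOn_shiftedQuartic ha hb).injOn (lt_min h h').le h₁.le
        (hx.trans hl₁.symm))
  refine ⟨l₁, l₂, hlt.ne, hl₁, hl₂, huniq, ?_⟩
  obtain ⟨z, hz, hz₀⟩ := exists_nonreal_root_of_monic_quadratic (p := l₁ + l₂ - 2 * d)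
    (q := d ^ 2 - a ^ 2 - b ^ 2 + (l₁ + l₂) * (l₁ + l₂ - 2 * d) - l₁ * l₂) (by
      intro x hx
      have hxF : shiftedQuartic a b c d x = 0 := by
        have := sub_mul_shiftedQuartic a b c d l₁ l₂ x
        rw [hl₁, hl₂, hx] at this
        simpa [sub_ne_zero.2 hlt.ne] using this
      -- A real root of the quotient is a double root, hence a critical point of the quartic.
      have hderiv : ∀ r s : ℝ, shiftedQuartic a b c d r = 0 → shiftedQuartic a b c d s = 0 →
          r ^ 2 + (r + s - 2 * d) * r +
            (d ^ 2 - a ^ 2 - b ^ 2 + (r + s) * (r + s - 2 * d) - r * s) = 0 → r ≠ s →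
          (r - d) * (r ^ 2 - b ^ 2) + r * ((r - d) ^ 2 - a ^ 2) = 0 := by
        intro r s hr hs h hrs
        have key : 2 * (r - s) * ((r - d) * (r ^ 2 - b ^ 2) + r * ((r - d) ^ 2 - a ^ 2)) =
            (shiftedQuartic a b c d r - shiftedQuartic a b c d s) + (r - s) ^ 2 *
            (r ^ 2 + (r + s - 2 * d) * r +
            (d ^ 2 - a ^ 2 - b ^ 2 + (r + s) * (r + s - 2 * d) - r * s)) := by
          unfold shiftedQuartic
          ring
        rw [hr, hs, h] at key
        simpa [sub_ne_zero.2 hrs] using key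
      rcases huniq x hxF with rfl | rfl
      · have h := hderiv x l₂ hl₁ hl₂ hx hlt.ne
        have hp : 0 < (x - d) ^ 2 - a ^ 2 := by nlinarith
        have hq : 0 < x ^ 2 - b ^ 2 := by nlinarith
        nlinarith [mul_pos hq (show 0 < d - x by linarith), mul_pos hp (show 0 < -x by linarith)]
      · have h := hderiv x l₁ hl₂ hl₁ (by linarith) hlt.ne'
        have hp : 0 < (x - d) ^ 2 - a ^ 2 := by nlinarith
        have hq : 0 < x ^ 2 - b ^ 2 := by nlinarith
        nlinarith [mul_pos hq (show 0 < x - d by linarith), mul_pos hp (show 0 < x by linarith)])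
  refine ⟨z, hz, ?_⟩
  have hne : (l₁ : ℂ) - l₂ ≠ 0 := by exact_mod_cast sub_ne_zero.2 hlt.ne
  have hl₁' : shiftedQuartic (a : ℂ) b c d l₁ = 0 := by
    unfold shiftedQuartic at hl₁ ⊢
    exact_mod_cast hl₁
  have hl₂' : shiftedQuartic (a : ℂ) b c d l₂ = 0 := by
    unfold shiftedQuartic at hl₂ ⊢
    exact_mod_cast hl₂
  have := sub_mul_shiftedQuartic (a : ℂ) b c d l₁ l₂ z
  push_cast at hz₀
  rw [hl₁', hl₂', hz₀] at this
  simpa [hne] using this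

end

lemma shiftedQuartic_ofReal (a b c d y : ℝ) :
    shiftedQuartic (a : ℂ) b c d y = (shiftedQuartic a b c d y : ℝ) := by
  simp [shiftedQuartic]

lemma bilayerCharPoly_conj (ρs ρb Hs Hb Us Ub : ℝ) (z : ℂ) :
    bilayerCharPoly ρs ρb Hs Hb Us Ub (starRingEnd ℂ z) =
      starRingEnd ℂ (bilayerCharPoly ρs ρb Hs Hb Us Ub z) := by
  simp [bilayerCharPoly]

lemma bilayerCharPoly_add_mul {ρs ρb Hs Hb Us Ub σ d : ℝ} (hHs : 0 ≤ Hs) (hHb : 0 ≤ Hb)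
    (hσ : σ ^ 2 = 1) (hd : Ub - Us = σ * d) (w : ℂ) :
    bilayerCharPoly ρs ρb Hs Hb Us Ub (Us + σ * w) =
      shiftedQuartic (√Hb : ℂ) (√Hs : ℝ) (ρs / ρb * Hs * Hb : ℝ) d w := by
  have hs : ((√Hs : ℝ) : ℂ) ^ 2 = Hs := by exact_mod_cast Real.sq_sqrt hHs
  have hb : ((√Hb : ℝ) : ℂ) ^ 2 = Hb := by exact_mod_cast Real.sq_sqrt hHb
  have hσ' : (σ : ℂ) ^ 2 = 1 := by exact_mod_cast hσ
  have hUb : (Ub : ℂ) = Us + σ * d := by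
    rw [← sub_eq_iff_eq_add']
    exact_mod_cast hd
  have h₁ : ((Ub : ℂ) - (Us + σ * w)) ^ 2 = (w - d) ^ 2 := by
    rw [hUb]
    linear_combination (w - d) ^ 2 * hσ'
  have h₂ : ((Us : ℂ) - (Us + σ * w)) ^ 2 = w ^ 2 := by
    linear_combination w ^ 2 * hσ'
  unfold bilayerCharPoly shiftedQuartic
  rw [h₁, h₂, hs, hb]
  push_cast
  ring

/-- Hyperbolicity domain of the bilayer shallow water system (Ovsjannikov):
there exist critical Froude numbers `0 < Fr₋ < Fr₊` such that for
`|U_b - U_s| < √H_b · Fr₋` the matrix `A` has four distinct real eigenvalues, for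
`√H_b · Fr₋ < |U_b - U_s| < √H_b · Fr₊` it has exactly two distinct real eigenvalues
and two distinct non-real complex conjugate eigenvalues, and for
`|U_b - U_s| > √H_b · Fr₊` it has four distinct real eigenvalues. -/
theorem bilayer_hyperbolicity_domain (ρs ρb Hs Hb : ℝ)
    (hρs : 0 < ρs) (hρ : ρs < ρb) (hHs : 0 < Hs) (hHb : 0 < Hb) :
    ∃ Frm Frp : ℝ, 0 < Frm ∧ Frm < Frp ∧
      ∀ Us Ub : ℝ,
        ((|Ub - Us| < Real.sqrt Hb * Frm →
          ∃ l : Fin 4 → ℝ, Function.Injective l ∧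
            ∀ i, bilayerCharPoly ρs ρb Hs Hb Us Ub (l i) = 0)
        ∧
        (Real.sqrt Hb * Frm < |Ub - Us| → |Ub - Us| < Real.sqrt Hb * Frp →
          ∃ l₁ l₂ : ℝ, l₁ ≠ l₂ ∧
            bilayerCharPoly ρs ρb Hs Hb Us Ub l₁ = 0 ∧
            bilayerCharPoly ρs ρb Hs Hb Us Ub l₂ = 0 ∧
            (∀ x : ℝ, bilayerCharPoly ρs ρb Hs Hb Us Ub x = 0 → x = l₁ ∨ x = l₂) ∧
            ∃ z : ℂ, z.im ≠ 0 ∧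
              bilayerCharPoly ρs ρb Hs Hb Us Ub z = 0 ∧
              bilayerCharPoly ρs ρb Hs Hb Us Ub (starRingEnd ℂ z) = 0)
        ∧
        (Real.sqrt Hb * Frp < |Ub - Us| →
          ∃ l : Fin 4 → ℝ, Function.Injective l ∧
            ∀ i, bilayerCharPoly ρs ρb Hs Hb Us Ub (l i) = 0)) := by
  have ha : 0 < √Hb := Real.sqrt_pos.2 hHb
  have hb : 0 < √Hs := Real.sqrt_pos.2 hHs
  have hρb : 0 < ρb := hρs.trans hρ
  have hc₀ : 0 < ρs / ρb * Hs * Hb := by positivity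
  have hc : ρs / ρb * Hs * Hb < √Hb ^ 2 * √Hs ^ 2 := by
    rw [Real.sq_sqrt hHb.le, Real.sq_sqrt hHs.le]
    nlinarith [mul_pos hHs hHb, (div_lt_one hρb).2 hρ]
  obtain ⟨m, M, hm, hmM, hlow, hO, hB, hhigh⟩ := exists_critical_shifts ha hb hc₀ hc
  refine ⟨m / √Hb, M / √Hb, by positivity, by gcongr, fun Us Ub ↦ ?_⟩
  rw [mul_div_cancel₀ _ ha.ne', mul_div_cancel₀ _ ha.ne']
  obtain ⟨σ, hσ, hd⟩ : ∃ σ : ℝ, σ ^ 2 = 1 ∧ Ub - Us = σ * |Ub - Us| := by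
    rcases abs_choice (Ub - Us) with h | h
    · exact ⟨1, by norm_num, by rw [h]; ring⟩
    · exact ⟨-1, by norm_num, by rw [h]; ring⟩
  have hσ₀ : σ ≠ 0 := by
    rintro rfl
    norm_num at hσ
  have hP := bilayerCharPoly_add_mul (ρs := ρs) (ρb := ρb) hHs.le hHb.le hσ hd
  have hPr : ∀ y : ℝ, bilayerCharPoly ρs ρb Hs Hb Us Ub ((Us + σ * y : ℝ) : ℂ) = 0 ↔
      shiftedQuartic (√Hb) (√Hs) (ρs / ρb * Hs * Hb) |Ub - Us| y = 0 := by
    intro y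
    push_cast
    rw [hP, shiftedQuartic_ofReal, Complex.ofReal_eq_zero]
  have hinj : Function.Injective fun y : ℝ ↦ Us + σ * y := fun x y h ↦ by
    simpa [hσ₀] using h
  have hfour : (∃ l : Fin 4 → ℝ, Function.Injective l ∧
      ∀ i, shiftedQuartic (√Hb) (√Hs) (ρs / ρb * Hs * Hb) |Ub - Us| (l i) = 0) →
      ∃ l : Fin 4 → ℝ, Function.Injective l ∧
        ∀ i, bilayerCharPoly ρs ρb Hs Hb Us Ub (l i) = 0 := by
    rintro ⟨l, hl, h⟩
    exact ⟨fun i ↦ Us + σ * l i, hinj.comp hl, fun i ↦ (hPr _).2 (h i)⟩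
  refine ⟨fun h ↦ hfour ?_, fun h₁ h₂ ↦ ?_, fun h ↦ hfour ?_⟩
  · obtain ⟨y, hyb, hya, hy⟩ := hlow _ (abs_nonneg _) h
    exact exists_four_roots_of_oval ha hb hc₀ hc (abs_nonneg _) hyb hya hy
  · obtain ⟨l₁, l₂, hne, hl₁, hl₂, huniq, z, hz, hz₀⟩ :=
      exists_two_real_roots ha hb hc₀ hc (hm.trans h₁) (hO _ h₁) (hB _ h₂)
    have hroot : bilayerCharPoly ρs ρb Hs Hb Us Ub (Us + σ * z) = 0 := (hP z).trans hz₀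
    refine ⟨Us + σ * l₁, Us + σ * l₂, hinj.ne hne, (hPr _).2 hl₁, (hPr _).2 hl₂, fun x hx ↦ ?_,
      Us + σ * z, by simp [hσ₀, hz], hroot, by rw [bilayerCharPoly_conj, hroot, map_zero]⟩
    obtain ⟨y, rfl⟩ : ∃ y, x = Us + σ * y := ⟨(x - Us) / σ, by field_simp; ring⟩
    exact (huniq y ((hPr y).1 hx)).imp (by rintro rfl; rfl) (by rintro rfl; rfl)
  · obtain ⟨y, hyb, hya, hy⟩ := hhigh _ h
    exact exists_four_roots_of_branch ha hb hc₀ hc (abs_nonneg _) hyb hya hy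
end

section
/- Let 0 < ρ_s < ρ_b, H_s, H_b > 0, γ = ρ_s/ρ_b, and suppose U_s = U_b = U. Set θ± = ((H_s + H_b) ± √((H_s − H_b)² + 4γ·H_s·H_b))/2. Then θ₊ > θ₋ > 0, and the eigenvalues of the matrix A(H_s, H_b, U, U) are exactly U + √θ₊, U − √θ₊, U + √θ₋, U − √θ₋; in particular A has four distinct real eigenvalues. -/
/-- In the zero-shear case `U_s = U_b = U`, with
`θ± = ((H_s + H_b) ± √((H_s - H_b)² + 4γ H_s H_b))/2`, one has `θ₊ > θ₋ > 0` and the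
eigenvalues of `A(H_s, H_b, U, U)` are exactly `U ± √θ₊` and `U ± √θ₋`; in particular
there are four distinct real eigenvalues. -/
theorem bilayer_eigenvalues_zero_shear (ρs ρb Hs Hb U θp θm : ℝ)
    (hρs : 0 < ρs) (hρ : ρs < ρb) (hHs : 0 < Hs) (hHb : 0 < Hb)
    (hθp : θp = ((Hs + Hb) + Real.sqrt ((Hs - Hb) ^ 2 + 4 * (ρs / ρb) * Hs * Hb)) / 2)
    (hθm : θm = ((Hs + Hb) - Real.sqrt ((Hs - Hb) ^ 2 + 4 * (ρs / ρb) * Hs * Hb)) / 2) :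
    θm < θp ∧ 0 < θm ∧
    Function.Injective
      ![U + Real.sqrt θp, U - Real.sqrt θp, U + Real.sqrt θm, U - Real.sqrt θm] ∧
    ∀ z : ℂ, bilayerCharPoly ρs ρb Hs Hb U U z = 0 ↔
      (z = ((U + Real.sqrt θp : ℝ) : ℂ) ∨ z = ((U - Real.sqrt θp : ℝ) : ℂ) ∨
        z = ((U + Real.sqrt θm : ℝ) : ℂ) ∨ z = ((U - Real.sqrt θm : ℝ) : ℂ)) := by
  set γ := ρs / ρb with hγ
  have hγ0 : 0 < γ := div_pos hρs (hρs.trans hρ)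
  have hγ1 : γ < 1 := (div_lt_one (hρs.trans hρ)).2 hρ
  have hHH : 0 < Hs * Hb := mul_pos hHs hHb
  have hγH : 0 < γ * (Hs * Hb) := mul_pos hγ0 hHH
  have hγH' : γ * (Hs * Hb) < Hs * Hb := mul_lt_of_lt_one_left hHH hγ1
  have hD : 0 < (Hs - Hb) ^ 2 + 4 * γ * Hs * Hb := by nlinarith [sq_nonneg (Hs - Hb)]
  have hs0 := Real.sqrt_pos.2 hD
  have hs2 := Real.sq_sqrt hD.le
  have hs1 : √((Hs - Hb) ^ 2 + 4 * γ * Hs * Hb) < Hs + Hb :=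
    (Real.sqrt_lt' (add_pos hHs hHb)).2 (by nlinarith)
  generalize √((Hs - Hb) ^ 2 + 4 * γ * Hs * Hb) = s at *
  have hlt : θm < θp := by linarith
  have hθm0 : 0 < θm := by linarith
  have hsum : θp + θm = Hs + Hb := by rw [hθp, hθm]; ring
  have hprod : θp * θm = Hs * Hb - γ * Hs * Hb := by
    rw [hθp, hθm]; linear_combination -hs2 / 4
  have ha2 := Real.sq_sqrt (hθm0.trans hlt).le
  have hb2 := Real.sq_sqrt hθm0.le
  have hb0 := Real.sqrt_pos.2 hθm0
  have hab := Real.sqrt_lt_sqrt hθm0.le hlt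
  generalize √θp = a at *
  generalize √θm = b at *
  refine ⟨hlt, hθm0, ?_, fun z => ?_⟩
  · intro i j hij
    fin_cases i <;> fin_cases j <;> simp at hij ⊢ <;> linarith
  · have hfac : bilayerCharPoly ρs ρb Hs Hb U U z =
        (z - (U + a : ℝ)) * ((z - (U - a : ℝ)) * ((z - (U + b : ℝ)) * (z - (U - b : ℝ)))) := by
      have hsumC : (a : ℂ) ^ 2 + (b : ℂ) ^ 2 = Hs + Hb := by
        rw [← ha2, ← hb2] at hsum
        exact_mod_cast hsum
      have hprodC : (a : ℂ) ^ 2 * (b : ℂ) ^ 2 = Hs * Hb - γ * Hs * Hb := by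
        rw [← ha2, ← hb2] at hprod
        exact_mod_cast hprod
      rw [bilayerCharPoly, ← hγ]
      push_cast
      linear_combination (U - z : ℂ) ^ 2 * hsumC - hprodC
    rw [hfac]
    simp only [mul_eq_zero, sub_eq_zero]
end

section
/- Let ρ_s, ρ_b > 0, H_s, H_b, U_s, U_b ∈ ℝ and γ = ρ_s/ρ_b. For every λ ∈ ℝ, the matrix S^λ is symmetric and the product matrix S^λ·A is symmetric, where A = [[U_s, 0, H_s, 0], [0, U_b, 0, H_b], [1, 1, U_s, 0], [γ, 1, 0, U_b]]. -/
open Matrix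

/-- For every `λ ∈ ℝ`, the candidate symmetrizer `S^λ` is symmetric and `S^λ · A`
is symmetric, where `A` is the coefficient matrix of the bilayer shallow water
system and `γ = ρ_s/ρ_b`. -/
theorem bilayer_symmetrizer_symm (ρs ρb Hs Hb Us Ub lam : ℝ)
    (hρs : 0 < ρs) (hρb : 0 < ρb) :
    ((!![ρs / ρb, ρs / ρb, (ρs / ρb) * (Us - lam), 0;
         ρs / ρb, 1, 0, Ub - lam;
         (ρs / ρb) * (Us - lam), 0, (ρs / ρb) * Hs, 0;
         0, Ub - lam, 0, Hb] : Matrix (Fin 4) (Fin 4) ℝ)).IsSymm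
    ∧
    ((!![ρs / ρb, ρs / ρb, (ρs / ρb) * (Us - lam), 0;
         ρs / ρb, 1, 0, Ub - lam;
         (ρs / ρb) * (Us - lam), 0, (ρs / ρb) * Hs, 0;
         0, Ub - lam, 0, Hb] : Matrix (Fin 4) (Fin 4) ℝ)
      * (!![Us, 0, Hs, 0;
            0, Ub, 0, Hb;
            1, 1, Us, 0;
            ρs / ρb, 1, 0, Ub] : Matrix (Fin 4) (Fin 4) ℝ)).IsSymm := by
  generalize ρs / ρb = γ
  constructor <;> refine IsSymm.ext fun i j => ?_
  · fin_cases i <;> fin_cases j <;> simp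
  · fin_cases i <;> fin_cases j <;> simp [Matrix.mul_apply, Fin.sum_univ_four] <;> ring
end

section
/- Let ρ_s, ρ_b > 0, H_s, H_b, U_s, U_b ∈ ℝ, γ = ρ_s/ρ_b and λ ∈ ℝ. Then det(S^λ) = γ²·(((U_b − λ)² − H_b)·((U_s − λ)² − H_s) − γ·H_s·H_b), i.e. the determinant of the symmetrizer equals γ² times the characteristic polynomial P of the bilayer system evaluated at λ. -/
open Matrix

/-- The determinant of the symmetrizer `S^λ` equals `γ²` times the characteristic
polynomial `P(λ) = ((U_b - λ)² - H_b)·((U_s - λ)² - H_s) - γ·H_s·H_b` of the bilayer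
system, where `γ = ρ_s/ρ_b`. -/
theorem bilayer_symmetrizer_det (ρs ρb Hs Hb Us Ub lam : ℝ)
    (hρs : 0 < ρs) (hρb : 0 < ρb) :
    Matrix.det
      (!![ρs / ρb, ρs / ρb, (ρs / ρb) * (Us - lam), 0;
          ρs / ρb, 1, 0, Ub - lam;
          (ρs / ρb) * (Us - lam), 0, (ρs / ρb) * Hs, 0;
          0, Ub - lam, 0, Hb] : Matrix (Fin 4) (Fin 4) ℝ)
      = (ρs / ρb) ^ 2 *
        (((Ub - lam) ^ 2 - Hb) * ((Us - lam) ^ 2 - Hs) - (ρs / ρb) * Hs * Hb) := by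
  simp [Matrix.det_succ_row_zero, Fin.sum_univ_succ, Fin.succAbove]
  ring
end

section
/- Let ρ_s, ρ_b > 0, H_s, H_b > 0, U_s, U_b ∈ ℝ, γ = ρ_s/ρ_b and λ ∈ ℝ. If (U_b − λ)² < H_b and P(λ) = ((U_b − λ)² − H_b)·((U_s − λ)² − H_s) − γ·H_s·H_b > 0, then the symmetric matrix S^λ is positive definite. -/
open Matrix

/-- The quadratic form of the bilayer symmetrizer is positive away from the origin: completing
squares writes a positive multiple of it as a sum of four weighted squares. -/
lemma bilayer_quadratic_form_pos {g Hs Hb u v x y z w : ℝ} (hg : 0 < g) (hHs : 0 < Hs)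
    (hHb : 0 < Hb) (hv : v ^ 2 < Hb) (hP : 0 < (v ^ 2 - Hb) * (u ^ 2 - Hs) - g * Hs * Hb)
    (hne : ¬(x = 0 ∧ y = 0 ∧ z = 0 ∧ w = 0)) :
    0 < g * x ^ 2 + 2 * g * x * y + 2 * g * u * x * z + y ^ 2 + 2 * v * y * w
      + g * Hs * z ^ 2 + Hb * w ^ 2 := by
  have hD : 0 < Hb - v ^ 2 := sub_pos.2 hv
  set P := (v ^ 2 - Hb) * (u ^ 2 - Hs) - g * Hs * Hb with hPdef
  refine pos_of_mul_pos_right (a := Hs * Hb * (Hb - v ^ 2)) ?_ (by positivity)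
  have key : Hs * Hb * (Hb - v ^ 2) * (g * x ^ 2 + 2 * g * x * y + 2 * g * u * x * z + y ^ 2
      + 2 * v * y * w + g * Hs * z ^ 2 + Hb * w ^ 2)
      = g * Hb * (Hb - v ^ 2) * (Hs * z + u * x) ^ 2 + Hs * (Hb - v ^ 2) * (Hb * w + v * y) ^ 2
        + Hs * ((Hb - v ^ 2) * y + g * Hb * x) ^ 2 + g * Hb * P * x ^ 2 := by
    rw [hPdef]; ring
  rw [key]
  by_cases hx : x = 0
  · subst hx
    by_cases hy : y = 0
    · subst hy
      by_cases hz : z = 0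
      · subst hz
        have hw : w ≠ 0 := fun hw => hne ⟨rfl, rfl, rfl, hw⟩
        simp only [mul_zero, add_zero]
        positivity
      · simp only [mul_zero, add_zero]
        positivity
    · have : (Hb - v ^ 2) * y ≠ 0 := mul_ne_zero hD.ne' hy
      simp only [mul_zero, add_zero]
      positivity
  · positivity

/-- If `(U_b - λ)² < H_b` and `P(λ) > 0`, then the symmetrizer `S^λ` of the bilayer
shallow water system is positive definite (`γ = ρ_s/ρ_b`). -/
theorem bilayer_symmetrizer_posDef (ρs ρb Hs Hb Us Ub lam : ℝ)
    (hρs : 0 < ρs) (hρb : 0 < ρb) (hHs : 0 < Hs) (hHb : 0 < Hb)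
    (hb : (Ub - lam) ^ 2 < Hb)
    (hP : ((Ub - lam) ^ 2 - Hb) * ((Us - lam) ^ 2 - Hs) - (ρs / ρb) * Hs * Hb > 0) :
    ((!![ρs / ρb, ρs / ρb, (ρs / ρb) * (Us - lam), 0;
         ρs / ρb, 1, 0, Ub - lam;
         (ρs / ρb) * (Us - lam), 0, (ρs / ρb) * Hs, 0;
         0, Ub - lam, 0, Hb] : Matrix (Fin 4) (Fin 4) ℝ)).PosDef := by
  refine posDef_iff_dotProduct_mulVec.2 ⟨?_, fun x hx => ?_⟩
  · ext i j
    fin_cases i <;> fin_cases j <;> simp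
  · have hne : ¬(x 0 = 0 ∧ x 1 = 0 ∧ x 2 = 0 ∧ x 3 = 0) := by
      rintro ⟨h0, h1, h2, h3⟩
      apply hx
      ext i
      fin_cases i <;> assumption
    have hpos := bilayer_quadratic_form_pos (div_pos hρs hρb) hHs hHb hb hP hne
    refine hpos.trans_eq ?_
    simp [dotProduct, mulVec, Fin.sum_univ_four]
    ring
end

section
/- Let 0 < ρ_s < ρ_b, H_s, H_b > 0, γ = ρ_s/ρ_b, and suppose U_s = U_b = U. Then the matrix S^U (the symmetrizer with λ = U, so that U_s^λ = U_b^λ = 0) is symmetric positive definite, and S^U·A(H_s, H_b, U, U) is symmetric. -/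
open Matrix

/-- The zero-shear symmetrizer with density ratio `γ ∈ (0, 1)` is positive definite: its quadratic
form is `γ (x₀ + x₁)² + (1 - γ) x₁² + γ Hs x₂² + Hb x₃²`. -/
lemma posDef_zero_shear_symmetrizer {γ Hs Hb : ℝ} (hγ : 0 < γ) (hγ1 : γ < 1)
    (hHs : 0 < Hs) (hHb : 0 < Hb) :
    (!![γ, γ, 0, 0; γ, 1, 0, 0; 0, 0, γ * Hs, 0; 0, 0, 0, Hb] :
      Matrix (Fin 4) (Fin 4) ℝ).PosDef := by
  refine Matrix.PosDef.of_dotProduct_mulVec_pos ?_ fun x hx => ?_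
  · ext i j
    fin_cases i <;> fin_cases j <;> simp
  · have h1 : 0 < 1 - γ := sub_pos.2 hγ1
    have key : star x ⬝ᵥ ((!![γ, γ, 0, 0; γ, 1, 0, 0; 0, 0, γ * Hs, 0; 0, 0, 0, Hb] :
        Matrix (Fin 4) (Fin 4) ℝ) *ᵥ x) =
        γ * (x 0 + x 1) ^ 2 + (1 - γ) * x 1 ^ 2 + γ * Hs * x 2 ^ 2 + Hb * x 3 ^ 2 := by
      simp [Matrix.mulVec, dotProduct, Fin.sum_univ_four]
      ring
    rw [key]
    by_contra! hle
    have p0 : 0 ≤ γ * (x 0 + x 1) ^ 2 := by positivity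
    have p1 : 0 ≤ (1 - γ) * x 1 ^ 2 := by positivity
    have p2 : 0 ≤ γ * Hs * x 2 ^ 2 := by positivity
    have p3 : 0 ≤ Hb * x 3 ^ 2 := by positivity
    have e01 : γ * (x 0 + x 1) ^ 2 = 0 := by linarith
    have e1 : (1 - γ) * x 1 ^ 2 = 0 := by linarith
    have e2 : γ * Hs * x 2 ^ 2 = 0 := by linarith
    have e3 : Hb * x 3 ^ 2 = 0 := by linarith
    simp only [mul_eq_zero, hγ.ne', h1.ne', hHs.ne', hHb.ne', false_or, or_self,
      pow_eq_zero_iff two_ne_zero] at e01 e1 e2 e3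
    refine hx (funext fun i => ?_)
    fin_cases i
    · simpa [e1] using e01
    · exact e1
    · exact e2
    · exact e3

/-- In the zero-shear case `U_s = U_b = U`, the symmetrizer `S^U` (i.e. `λ = U`, so
`U_s^λ = U_b^λ = 0`) is symmetric positive definite and `S^U · A(H_s, H_b, U, U)` is
symmetric, where `γ = ρ_s/ρ_b`. -/
theorem bilayer_symmetrizer_zero_shear (ρs ρb Hs Hb U : ℝ)
    (hρs : 0 < ρs) (hρ : ρs < ρb) (hHs : 0 < Hs) (hHb : 0 < Hb) :
    ((!![ρs / ρb, ρs / ρb, (ρs / ρb) * (U - U), 0;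
         ρs / ρb, 1, 0, U - U;
         (ρs / ρb) * (U - U), 0, (ρs / ρb) * Hs, 0;
         0, U - U, 0, Hb] : Matrix (Fin 4) (Fin 4) ℝ)).PosDef
    ∧
    ((!![ρs / ρb, ρs / ρb, (ρs / ρb) * (U - U), 0;
         ρs / ρb, 1, 0, U - U;
         (ρs / ρb) * (U - U), 0, (ρs / ρb) * Hs, 0;
         0, U - U, 0, Hb] : Matrix (Fin 4) (Fin 4) ℝ)
      * (!![U, 0, Hs, 0;
            0, U, 0, Hb;
            1, 1, U, 0;
            ρs / ρb, 1, 0, U] : Matrix (Fin 4) (Fin 4) ℝ)).IsSymm := by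
  simp only [sub_self, mul_zero]
  refine ⟨posDef_zero_shear_symmetrizer (div_pos hρs (hρs.trans hρ))
    ((div_lt_one (hρs.trans hρ)).2 hρ) hHs hHb, ?_⟩
  ext i j
  fin_cases i <;> fin_cases j <;> simp [Matrix.mul_apply, Fin.sum_univ_four] <;> ring
end

section
/- Let 0 < ρ_s < ρ_b and H_s, H_b > 0, and set γ = ρ_s/ρ_b. There exists F > 0 such that for all U_s, U_b ∈ ℝ with |U_b − U_s| < √H_b·F, there exists λ ∈ [min(U_s, U_b), max(U_s, U_b)] such that the matrix S^λ is symmetric positive definite and the matrix S^λ·A(H_s, H_b, U_s, U_b) is symmetric. -/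
open Matrix

/-- Where the upper layer is at rest relative to `lam`, the symmetrizer is positive definite as soon
as the square of the relative velocity `u` of the lower layer is below `(1 - γ) * Hb`. -/
theorem posDef_bilayer_symmetrizer {γ Hs Hb u : ℝ} (hγ : 0 < γ) (hHs : 0 < Hs) (hHb : 0 < Hb)
    (hu : u ^ 2 < (1 - γ) * Hb) :
    (!![γ, γ, 0, 0; γ, 1, 0, u; 0, 0, γ * Hs, 0; 0, u, 0, Hb] :
      Matrix (Fin 4) (Fin 4) ℝ).PosDef := by
  refine Matrix.PosDef.of_dotProduct_mulVec_pos ?_ fun v hv => ?_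
  · ext i j
    fin_cases i <;> fin_cases j <;> simp
  · have hquad : Hb * (star v ⬝ᵥ (!![γ, γ, 0, 0; γ, 1, 0, u; 0, 0, γ * Hs, 0; 0, u, 0, Hb] :
        Matrix (Fin 4) (Fin 4) ℝ) *ᵥ v) =
        Hb * γ * (v 0 + v 1) ^ 2 + Hb * γ * Hs * v 2 ^ 2 + (Hb * v 3 + u * v 1) ^ 2
          + ((1 - γ) * Hb - u ^ 2) * v 1 ^ 2 := by
      simp [dotProduct, Matrix.mulVec, Fin.sum_univ_four]
      ring
    refine pos_of_mul_pos_right (a := Hb) ?_ hHb.le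
    rw [hquad]
    have hd : 0 < (1 - γ) * Hb - u ^ 2 := sub_pos.2 hu
    by_cases h1 : v 1 = 0
    · by_cases h0 : v 0 = 0
      · by_cases h2 : v 2 = 0
        · have h3 : v 3 ≠ 0 := fun h3 => hv (by ext i; fin_cases i <;> simp [*])
          rw [h0, h1, h2]
          simp only [mul_zero, add_zero]
          positivity
        · positivity
      · rw [h1]
        simp only [add_zero]
        positivity
    · positivity

/-- Existence of a symmetrizer for the bilayer shallow water system under a smallness
condition on the shear: there exists `F > 0` such that whenever `|U_b - U_s| < √H_b · F`,
one can find `λ ∈ [min(U_s,U_b), max(U_s,U_b)]` for which `S^λ` is symmetric positive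
definite and `S^λ · A` is symmetric (`γ = ρ_s/ρ_b`). -/
theorem bilayer_symmetrizer_exists (ρs ρb Hs Hb : ℝ)
    (hρs : 0 < ρs) (hρ : ρs < ρb) (hHs : 0 < Hs) (hHb : 0 < Hb) :
    ∃ F : ℝ, 0 < F ∧
      ∀ Us Ub : ℝ, |Ub - Us| < Real.sqrt Hb * F →
        ∃ lam : ℝ, lam ∈ Set.Icc (min Us Ub) (max Us Ub) ∧
          ((!![ρs / ρb, ρs / ρb, (ρs / ρb) * (Us - lam), 0;
               ρs / ρb, 1, 0, Ub - lam;
               (ρs / ρb) * (Us - lam), 0, (ρs / ρb) * Hs, 0;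
               0, Ub - lam, 0, Hb] : Matrix (Fin 4) (Fin 4) ℝ)).PosDef
          ∧
          ((!![ρs / ρb, ρs / ρb, (ρs / ρb) * (Us - lam), 0;
               ρs / ρb, 1, 0, Ub - lam;
               (ρs / ρb) * (Us - lam), 0, (ρs / ρb) * Hs, 0;
               0, Ub - lam, 0, Hb] : Matrix (Fin 4) (Fin 4) ℝ)
            * (!![Us, 0, Hs, 0;
                  0, Ub, 0, Hb;
                  1, 1, Us, 0;
                  ρs / ρb, 1, 0, Ub] : Matrix (Fin 4) (Fin 4) ℝ)).IsSymm := by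
  have hρb : 0 < ρb := hρs.trans hρ
  have hγ : 0 < ρs / ρb := div_pos hρs hρb
  have hγ1 : 0 < 1 - ρs / ρb := sub_pos.2 ((div_lt_one hρb).2 hρ)
  refine ⟨Real.sqrt (1 - ρs / ρb), Real.sqrt_pos.2 hγ1, fun Us Ub h => ?_⟩
  refine ⟨Us, ⟨min_le_left _ _, le_max_left _ _⟩, ?_, ?_⟩
  · have hu : (Ub - Us) ^ 2 < (1 - ρs / ρb) * Hb := by
      rw [← Real.sqrt_mul hHb.le, Real.lt_sqrt (abs_nonneg _), sq_abs] at h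
      linarith
    simpa only [sub_self, mul_zero] using posDef_bilayer_symmetrizer hγ hHs hHb hu
  · ext i j
    fin_cases i <;> fin_cases j <;> simp [Matrix.mul_apply, Fin.sum_univ_four] <;> ring
end

section
/- Let M̄ > 0 and let ρ₁, ρ₂ : (−1,0) → (0,∞) be measurable functions such that ∫_{−1}^0 ρ_ℓ(r) dr ≤ M̄ and 1/ρ_ℓ(r) ≤ M̄ for almost every r ∈ (−1,0), for ℓ ∈ {1,2}. Then for every bounded measurable h : (−1,0) → ℝ and almost every r ∈ (−1,0), |(1/ρ₁(r))·(M[ρ₁]h)(r) − (1/ρ₂(r))·(M[ρ₂]h)(r)| ≤ (M̄³·|ρ₁(r) − ρ₂(r)| + M̄·∫_{−1}^0 |ρ₁(r') − ρ₂(r')| dr')·(ess sup_{r'∈(−1,0)} |h(r')|). -/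
open MeasureTheory intervalIntegral

/-- If `|h| ≤ E` almost everywhere on `(a,b)`, then `∫_r^b f·h` is bounded by `E·∫_a^b |f|`. -/
lemma abs_integral_mul_le_of_ae_abs_le {a b r E : ℝ} {f h : ℝ → ℝ} (hr : r ∈ Set.Ioo a b)
    (hf : IntegrableOn f (Set.Ioo a b)) (hE : ∀ᵐ x ∂(volume.restrict (Set.Ioo a b)), |h x| ≤ E) :
    |∫ x in r..b, f x * h x| ≤ (∫ x in Set.Ioo a b, |f x|) * E := by
  have hsub : Set.Ioo r b ⊆ Set.Ioo a b := Set.Ioo_subset_Ioo_left hr.1.le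
  have hE0 : 0 ≤ E := by
    have hne : (ae (volume.restrict (Set.Ioo a b))).NeBot := by
      rw [ae_neBot, Ne, Measure.restrict_eq_zero, Real.volume_Ioo, ENNReal.ofReal_eq_zero]
      linarith [hr.1, hr.2]
    obtain ⟨x, hx⟩ := hE.exists
    exact (abs_nonneg _).trans hx
  have hg : IntegrableOn (fun x => |f x| * E) (Set.Ioo a b) := hf.abs.mul_const E
  rw [intervalIntegral.integral_of_le hr.2.le, integral_Ioc_eq_integral_Ioo,
    ← MeasureTheory.integral_mul_const]
  calc |∫ x in Set.Ioo r b, f x * h x| ≤ ∫ x in Set.Ioo r b, |f x| * E := by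
        rw [← Real.norm_eq_abs]
        refine norm_integral_le_of_norm_le (hg.mono_set hsub) ?_
        filter_upwards [ae_restrict_of_ae_restrict_of_subset hsub hE] with x hx
        rw [Real.norm_eq_abs, abs_mul]
        gcongr
    _ ≤ ∫ x in Set.Ioo a b, |f x| * E :=
        setIntegral_mono_set hg (ae_of_all _ fun x => by positivity) hsub.eventuallyLE

/-- Lipschitz continuity of the Montgomery operator
`(M[ρ]h)(r) = ρ(r)·∫_{-1}^r h + ∫_r^0 ρ·h` with respect to the density: if
`∫_{-1}^0 ρ_ℓ ≤ Mbar` and `1/ρ_ℓ ≤ Mbar` a.e. on `(-1,0)` for `ℓ ∈ {1,2}`, then for every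
bounded measurable `h` and almost every `r ∈ (-1,0)`,
`|(1/ρ₁)(M[ρ₁]h)(r) - (1/ρ₂)(M[ρ₂]h)(r)|
  ≤ (Mbar³·|ρ₁(r) - ρ₂(r)| + Mbar·∫_{-1}^0 |ρ₁ - ρ₂|) · ess sup |h|`. -/
theorem montgomery_lipschitz (Mbar : ℝ) (hMbar : 0 < Mbar) (ρ₁ ρ₂ : ℝ → ℝ)
    (hρ₁pos : ∀ r ∈ Set.Ioo (-1 : ℝ) 0, 0 < ρ₁ r)
    (hρ₂pos : ∀ r ∈ Set.Ioo (-1 : ℝ) 0, 0 < ρ₂ r)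
    (hρ₁meas : Measurable ρ₁) (hρ₂meas : Measurable ρ₂)
    (hρ₁int : IntegrableOn ρ₁ (Set.Ioo (-1 : ℝ) 0))
    (hρ₂int : IntegrableOn ρ₂ (Set.Ioo (-1 : ℝ) 0))
    (hρ₁L1 : (∫ r in Set.Ioo (-1 : ℝ) 0, ρ₁ r) ≤ Mbar)
    (hρ₂L1 : (∫ r in Set.Ioo (-1 : ℝ) 0, ρ₂ r) ≤ Mbar)
    (hρ₁inv : ∀ᵐ r ∂(volume.restrict (Set.Ioo (-1 : ℝ) 0)), 1 / ρ₁ r ≤ Mbar)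
    (hρ₂inv : ∀ᵐ r ∂(volume.restrict (Set.Ioo (-1 : ℝ) 0)), 1 / ρ₂ r ≤ Mbar) :
    ∀ (h : ℝ → ℝ) (C : ℝ), Measurable h → (∀ r ∈ Set.Ioo (-1 : ℝ) 0, |h r| ≤ C) →
      ∀ᵐ r ∂(volume.restrict (Set.Ioo (-1 : ℝ) 0)),
        |(1 / ρ₁ r) * (ρ₁ r * (∫ r' in (-1 : ℝ)..r, h r')
              + ∫ r' in r..(0 : ℝ), ρ₁ r' * h r')
          - (1 / ρ₂ r) * (ρ₂ r * (∫ r' in (-1 : ℝ)..r, h r')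
              + ∫ r' in r..(0 : ℝ), ρ₂ r' * h r')|
        ≤ (Mbar ^ 3 * |ρ₁ r - ρ₂ r| + Mbar * ∫ r' in Set.Ioo (-1 : ℝ) 0, |ρ₁ r' - ρ₂ r'|)
            * essSup (fun r' => |h r'|) (volume.restrict (Set.Ioo (-1 : ℝ) 0)) := by
  intro h C hh hC
  have hE : ∀ᵐ r ∂(volume.restrict (Set.Ioo (-1 : ℝ) 0)),
      |h r| ≤ essSup (fun r' => |h r'|) (volume.restrict (Set.Ioo (-1 : ℝ) 0)) :=
    ae_le_essSup (Filter.isBoundedUnder_of_eventually_le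
      ((ae_restrict_mem measurableSet_Ioo).mono hC))
  set E := essSup (fun r' => |h r'|) (volume.restrict (Set.Ioo (-1 : ℝ) 0))
  have hmul : ∀ ρ : ℝ → ℝ, IntegrableOn ρ (Set.Ioo (-1 : ℝ) 0) → ∀ r ∈ Set.Ioo (-1 : ℝ) 0,
      IntervalIntegrable (fun x => ρ x * h x) volume r 0 := by
    intro ρ hρ r hr
    have hsub : Set.Ioo r 0 ⊆ Set.Ioo (-1 : ℝ) 0 := Set.Ioo_subset_Ioo_left hr.1.le
    rw [intervalIntegrable_iff_integrableOn_Ioo_of_le hr.2.le]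
    refine IntegrableOn.mono_set ?_ hsub
    exact Integrable.mul_bdd hρ hh.aestronglyMeasurable ((ae_restrict_mem measurableSet_Ioo).mono hC)
  filter_upwards [ae_restrict_mem measurableSet_Ioo, hρ₁inv, hρ₂inv, hE] with r hr h1 h2 hEr
  have hE0 : 0 ≤ E := (abs_nonneg _).trans hEr
  have p1 := hρ₁pos r hr
  have p2 := hρ₂pos r hr
  have hA : |∫ x in r..(0 : ℝ), ρ₁ x * h x| ≤ Mbar * E := by
    refine (abs_integral_mul_le_of_ae_abs_le hr hρ₁int hE).trans ?_
    have heq : ∫ x in Set.Ioo (-1 : ℝ) 0, |ρ₁ x| = ∫ x in Set.Ioo (-1 : ℝ) 0, ρ₁ x :=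
      setIntegral_congr_fun measurableSet_Ioo fun x hx => abs_of_pos (hρ₁pos x hx)
    rw [heq]
    gcongr
  have hB : |∫ x in r..(0 : ℝ), (ρ₁ x - ρ₂ x) * h x|
      ≤ (∫ x in Set.Ioo (-1 : ℝ) 0, |ρ₁ x - ρ₂ x|) * E :=
    abs_integral_mul_le_of_ae_abs_le hr (hρ₁int.sub hρ₂int) hE
  have hsplit : ∫ x in r..(0 : ℝ), (ρ₁ x - ρ₂ x) * h x
      = (∫ x in r..(0 : ℝ), ρ₁ x * h x) - ∫ x in r..(0 : ℝ), ρ₂ x * h x := by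
    rw [← intervalIntegral.integral_sub (hmul ρ₁ hρ₁int r hr) (hmul ρ₂ hρ₂int r hr)]
    simp only [sub_mul]
  rw [hsplit] at hB
  set I := ∫ r' in (-1 : ℝ)..r, h r'
  set A := ∫ x in r..(0 : ℝ), ρ₁ x * h x
  set B := ∫ x in r..(0 : ℝ), ρ₂ x * h x
  set D := ∫ x in Set.Ioo (-1 : ℝ) 0, |ρ₁ x - ρ₂ x|
  have hid : (1 / ρ₁ r) * (ρ₁ r * I + A) - (1 / ρ₂ r) * (ρ₂ r * I + B)
      = (1 / ρ₁ r) * (1 / ρ₂ r) * (ρ₂ r - ρ₁ r) * A + (1 / ρ₂ r) * (A - B) := by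
    field_simp
    ring
  have q1 : 0 < 1 / ρ₁ r := by positivity
  have q2 : 0 < 1 / ρ₂ r := by positivity
  rw [hid]
  calc _ ≤ |(1 / ρ₁ r) * (1 / ρ₂ r) * (ρ₂ r - ρ₁ r) * A| + |(1 / ρ₂ r) * (A - B)| :=
        abs_add_le _ _
    _ = (1 / ρ₁ r) * (1 / ρ₂ r) * |ρ₁ r - ρ₂ r| * |A| + (1 / ρ₂ r) * |A - B| := by
        rw [abs_mul, abs_mul, abs_mul, abs_mul, abs_of_pos q1, abs_of_pos q2,
          abs_sub_comm (ρ₂ r)]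
    _ ≤ Mbar * Mbar * |ρ₁ r - ρ₂ r| * (Mbar * E) + Mbar * (D * E) := by
        gcongr
    _ = _ := by ring
end

section
/- Let κ ≥ 0, ρ_s, ρ_b > 0, let Ū_s, Ū_b ∈ ℝ and 0 < H̄_s < 1, H̄_b = 1 − H̄_s. Let H_s, H_b, U_s, U_b : ℝ × ℝ → ℝ be twice continuously differentiable functions of (t,x) with H̄_s + H_s > 0 and H̄_b + H_b > 0 everywhere, satisfying pointwise the bilayer shallow water system: ∂_t H_s + ∂_x((H̄_s + H_s)(Ū_s + U_s)) = κ·∂_x²H_s, ∂_t H_b + ∂_x((H̄_b + H_b)(Ū_b + U_b)) = κ·∂_x²H_b, ∂_t U_s + (Ū_s + U_s − κ·∂_xH_s/(H̄_s + H_s))·∂_x U_s + ∂_x H_s + ∂_x H_b = 0, and ∂_t U_b + (Ū_b + U_b − κ·∂_xH_b/(H̄_b + H_b))·∂_x U_b + (ρ_s/ρ_b)·∂_x H_s + ∂_x H_b = 0. Define, for r ∈ (−1,0) \ {−H̄_s}: ρ̄(r) = ρ_s and ū(r) = Ū_s and h(t,x,r) = H_s(t,x)/H̄_s and u(t,x,r)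 = U_s(t,x) when r ∈ (−H̄_s, 0), and ρ̄(r) = ρ_b, ū(r) = Ū_b, h(t,x,r) = H_b(t,x)/H̄_b, u(t,x,r) = U_b(t,x) when r ∈ (−1, −H̄_s). Then for every (t,x) ∈ ℝ² and every r ∈ (−1,0) \ {−H̄_s}, the hydrostatic Euler equations in isopycnal coordinates hold: ∂_t h + ∂_x((1 + h)(ū + u)) = κ·∂_x²h and ∂_t u + (ū + u − κ·∂_x h/(1 + h))·∂_x u + (1/ρ̄(r))·∂_x Ψ(t,x,r) = 0, where Ψ(t,x,r) = ρ̄(r)·∫_{−1}^r h(t,x,r') dr' + ∫_r^0 ρ̄(r')·h(t,x,r') dr'. -/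
open MeasureTheory intervalIntegral

/-- A function equal to a constant on `(a, b)` is interval integrable on `[a, b]`. -/
theorem intervalIntegrable_of_eq_const_on_Ioo {f : ℝ → ℝ} {a b c : ℝ} (hab : a ≤ b)
    (hf : ∀ r ∈ Set.Ioo a b, f r = c) : IntervalIntegrable f volume a b := by
  rw [intervalIntegrable_iff_integrableOn_Ioo_of_le hab]
  exact (integrableOn_congr_fun hf measurableSet_Ioo).2
    (integrableOn_const (by simp) (by simp))

/-- The integral over `[a, b]` of a function equal to a constant on `(a, b)`. -/
theorem intervalIntegral_of_eq_const_on_Ioo {f : ℝ → ℝ} {a b c : ℝ} (hab : a ≤ b)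
    (hf : ∀ r ∈ Set.Ioo a b, f r = c) : ∫ r in a..b, f r = (b - a) * c := by
  rw [intervalIntegral.integral_of_le hab, integral_Ioc_eq_integral_Ioo,
    setIntegral_congr_fun measurableSet_Ioo hf, ← integral_Ioc_eq_integral_Ioo,
    ← intervalIntegral.integral_of_le hab, intervalIntegral.integral_const, smul_eq_mul]

/-- The integral over `[a, c]` of a function constant on each of `(a, b)` and `(b, c)`. -/
theorem intervalIntegral_of_eq_const_on_Ioo_Ioo {f : ℝ → ℝ} {a b c d e : ℝ}
    (hab : a ≤ b) (hbc : b ≤ c) (hd : ∀ r ∈ Set.Ioo a b, f r = d)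
    (he : ∀ r ∈ Set.Ioo b c, f r = e) :
    ∫ r in a..c, f r = (b - a) * d + (c - b) * e := by
  rw [← intervalIntegral.integral_add_adjacent_intervals
    (intervalIntegrable_of_eq_const_on_Ioo hab hd)
    (intervalIntegrable_of_eq_const_on_Ioo hbc he),
    intervalIntegral_of_eq_const_on_Ioo hab hd, intervalIntegral_of_eq_const_on_Ioo hbc he]

/-- The layer thickness equation, divided by the reference depth `B` of the layer. -/
theorem thickness_equation_div {κ B V : ℝ} (hB : B ≠ 0) {H U : ℝ → ℝ → ℝ} {t x : ℝ}
    (heq : deriv (fun t' => H t' x) t + deriv (fun x' => (B + H t x') * (V + U t x')) x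
      = κ * deriv (fun x' => deriv (fun y => H t y) x') x) :
    deriv (fun t' => H t' x / B) t + deriv (fun x' => (1 + H t x' / B) * (V + U t x')) x
      = κ * deriv (fun x' => deriv (fun y => H t y / B) x') x := by
  have hprod : (fun x' => (1 + H t x' / B) * (V + U t x'))
      = fun x' => (B + H t x') * (V + U t x') / B := by
    funext x'
    field_simp
  simp only [hprod, deriv_div_const]
  rw [← add_div, heq, mul_div_assoc]

/-- The diffusive velocity correction is unchanged by rescaling the layer thickness. -/
theorem diffusive_velocity_div {κ B : ℝ} (hB : B ≠ 0) {H : ℝ → ℝ} {x : ℝ}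
    (hpos : 0 < B + H x) :
    κ * deriv (fun x' => H x' / B) x / (1 + H x / B)
      = κ * deriv (fun x' => H x') x / (B + H x) := by
  have h_eq : 1 + H x / B = (B + H x) / B := by field_simp
  rw [deriv_div_const, h_eq]
  field_simp

/-- Solutions of the bilayer shallow water system (with thickness diffusivity `κ`)
provide exact solutions to the hydrostatic Euler equations in isopycnal coordinates
with piecewise constant density and velocity profiles: if `(H_s, H_b, U_s, U_b)` is a
`C²` solution of the bilayer system, then the piecewise profiles
`ρ̄, ū, h, u` (equal to the upper-layer data on `(-H̄_s, 0)` and to the lower-layer data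
on `(-1, -H̄_s)`) satisfy, for every `(t,x)` and every `r ∈ (-1,0) \ {-H̄_s}`,
`∂_t h + ∂_x((1+h)(ū+u)) = κ ∂_x² h` and
`∂_t u + (ū + u - κ ∂_x h/(1+h)) ∂_x u + (1/ρ̄) ∂_x Ψ = 0`, where
`Ψ(t,x,r) = ρ̄(r)·∫_{-1}^r h(t,x,r') dr' + ∫_r^0 ρ̄(r')·h(t,x,r') dr'`. -/
theorem bilayer_solves_hydrostatic_euler
    (κ ρs ρb Ubars Ubarb Hbars Hbarb : ℝ)
    (hκ : 0 ≤ κ) (hρs : 0 < ρs) (hρb : 0 < ρb)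
    (hHbars : 0 < Hbars) (hHbars1 : Hbars < 1) (hHbarb : Hbarb = 1 - Hbars)
    (Hs Hb Us Ub : ℝ → ℝ → ℝ)
    (hregHs : ContDiff ℝ 2 (fun p : ℝ × ℝ => Hs p.1 p.2))
    (hregHb : ContDiff ℝ 2 (fun p : ℝ × ℝ => Hb p.1 p.2))
    (hregUs : ContDiff ℝ 2 (fun p : ℝ × ℝ => Us p.1 p.2))
    (hregUb : ContDiff ℝ 2 (fun p : ℝ × ℝ => Ub p.1 p.2))
    (hposs : ∀ t x : ℝ, 0 < Hbars + Hs t x)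
    (hposb : ∀ t x : ℝ, 0 < Hbarb + Hb t x)
    -- the bilayer shallow water system
    (heqHs : ∀ t x : ℝ,
      deriv (fun t' => Hs t' x) t
        + deriv (fun x' => (Hbars + Hs t x') * (Ubars + Us t x')) x
      = κ * deriv (fun x' => deriv (fun y => Hs t y) x') x)
    (heqHb : ∀ t x : ℝ,
      deriv (fun t' => Hb t' x) t
        + deriv (fun x' => (Hbarb + Hb t x') * (Ubarb + Ub t x')) x
      = κ * deriv (fun x' => deriv (fun y => Hb t y) x') x)
    (heqUs : ∀ t x : ℝ,
      deriv (fun t' => Us t' x) t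
        + (Ubars + Us t x - κ * deriv (fun x' => Hs t x') x / (Hbars + Hs t x))
            * deriv (fun x' => Us t x') x
        + deriv (fun x' => Hs t x') x + deriv (fun x' => Hb t x') x = 0)
    (heqUb : ∀ t x : ℝ,
      deriv (fun t' => Ub t' x) t
        + (Ubarb + Ub t x - κ * deriv (fun x' => Hb t x') x / (Hbarb + Hb t x))
            * deriv (fun x' => Ub t x') x
        + (ρs / ρb) * deriv (fun x' => Hs t x') x + deriv (fun x' => Hb t x') x = 0)
    -- the piecewise (bilayer) profiles
    (ρbar ubar : ℝ → ℝ) (h u : ℝ → ℝ → ℝ → ℝ)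
    (hρbar_up : ∀ r ∈ Set.Ioo (-Hbars) (0 : ℝ), ρbar r = ρs)
    (hρbar_low : ∀ r ∈ Set.Ioo (-1 : ℝ) (-Hbars), ρbar r = ρb)
    (hubar_up : ∀ r ∈ Set.Ioo (-Hbars) (0 : ℝ), ubar r = Ubars)
    (hubar_low : ∀ r ∈ Set.Ioo (-1 : ℝ) (-Hbars), ubar r = Ubarb)
    (hh_up : ∀ t x : ℝ, ∀ r ∈ Set.Ioo (-Hbars) (0 : ℝ), h t x r = Hs t x / Hbars)
    (hh_low : ∀ t x : ℝ, ∀ r ∈ Set.Ioo (-1 : ℝ) (-Hbars), h t x r = Hb t x / Hbarb)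
    (hu_up : ∀ t x : ℝ, ∀ r ∈ Set.Ioo (-Hbars) (0 : ℝ), u t x r = Us t x)
    (hu_low : ∀ t x : ℝ, ∀ r ∈ Set.Ioo (-1 : ℝ) (-Hbars), u t x r = Ub t x) :
    ∀ t x : ℝ, ∀ r ∈ Set.Ioo (-1 : ℝ) 0, r ≠ -Hbars →
      (deriv (fun t' => h t' x r) t
          + deriv (fun x' => (1 + h t x' r) * (ubar r + u t x' r)) x
        = κ * deriv (fun x' => deriv (fun y => h t y r) x') x)
      ∧
      (deriv (fun t' => u t' x r) t
          + (ubar r + u t x r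
              - κ * deriv (fun x' => h t x' r) x / (1 + h t x r))
            * deriv (fun x' => u t x' r) x
          + (1 / ρbar r) *
            deriv (fun x' =>
              ρbar r * (∫ r' in (-1 : ℝ)..r, h t x' r')
                + ∫ r' in r..(0 : ℝ), ρbar r' * h t x' r') x
        = 0) := by
  intro t x r hr hne
  have hBs : Hbars ≠ 0 := hHbars.ne'
  have hBb : Hbarb ≠ 0 := by rw [hHbarb]; linarith
  have hdiff : ∀ H : ℝ → ℝ → ℝ, ContDiff ℝ 2 (fun p : ℝ × ℝ => H p.1 p.2) →
      DifferentiableAt ℝ (fun x' => H t x') x := fun H hH =>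
    ((hH.differentiable two_ne_zero).comp
      ((differentiable_const t).prodMk differentiable_id)) x
  have hds := hdiff Hs hregHs
  have hdb := hdiff Hb hregHb
  rcases lt_or_gt_of_ne hne with hlow | hup
  · have hmem : r ∈ Set.Ioo (-1 : ℝ) (-Hbars) := ⟨hr.1, hlow⟩
    have hΨ : ∀ x', ρb * (∫ r' in (-1 : ℝ)..r, h t x' r')
        + ∫ r' in r..(0 : ℝ), ρbar r' * h t x' r' = ρb * Hb t x' + ρs * Hs t x' := by
      intro x'
      rw [intervalIntegral_of_eq_const_on_Ioo hr.1.le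
          fun s hs => hh_low t x' s ⟨hs.1, hs.2.trans hlow⟩,
        intervalIntegral_of_eq_const_on_Ioo_Ioo (d := ρb * (Hb t x' / Hbarb))
          (e := ρs * (Hs t x' / Hbars)) hlow.le (by linarith)
          (fun s hs => by
            have hs' : s ∈ Set.Ioo (-1 : ℝ) (-Hbars) := ⟨hr.1.trans hs.1, hs.2⟩
            rw [hρbar_low s hs', hh_low t x' s hs'])
          (fun s hs => by rw [hρbar_up s hs, hh_up t x' s hs])]
      field_simp
      rw [hHbarb]
      ring
    simp only [hh_low _ _ r hmem, hu_low _ _ r hmem, hubar_low r hmem, hρbar_low r hmem, hΨ]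
    refine ⟨thickness_equation_div hBb (heqHb t x), ?_⟩
    rw [diffusive_velocity_div hBb (hposb t x),
      deriv_fun_add (hdb.const_mul ρb) (hds.const_mul ρs), deriv_const_mul _ hdb,
      deriv_const_mul _ hds, ← heqUb t x]
    field_simp
    ring
  · have hmem : r ∈ Set.Ioo (-Hbars) (0 : ℝ) := ⟨hup, hr.2⟩
    have hΨ : ∀ x', ρs * (∫ r' in (-1 : ℝ)..r, h t x' r')
        + ∫ r' in r..(0 : ℝ), ρbar r' * h t x' r' = ρs * (Hs t x' + Hb t x') := by
      intro x'
      rw [intervalIntegral_of_eq_const_on_Ioo_Ioo (by linarith) hup.le (hh_low t x')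
          fun s hs => hh_up t x' s ⟨hs.1, hs.2.trans hr.2⟩,
        intervalIntegral_of_eq_const_on_Ioo (c := ρs * (Hs t x' / Hbars)) hr.2.le
          (fun s hs => by
            have hs' : s ∈ Set.Ioo (-Hbars) (0 : ℝ) := ⟨hup.trans hs.1, hs.2⟩
            rw [hρbar_up s hs', hh_up t x' s hs'])]
      field_simp
      rw [hHbarb]
      ring
    simp only [hh_up _ _ r hmem, hu_up _ _ r hmem, hubar_up r hmem, hρbar_up r hmem, hΨ]
    refine ⟨thickness_equation_div hBs (heqHs t x), ?_⟩
    rw [diffusive_velocity_div hBs (hposs t x), deriv_const_mul _ (hds.fun_add hdb),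
      deriv_fun_add hds hdb, ← heqUs t x]
    field_simp
    ring
end

section
/- Let κ > 0, ρ_s, ρ_b > 0, Ū_s, Ū_b ∈ ℝ, H̄_s, H̄_b > 0. Let H_s, H_b, U_s, U_b : ℝ × ℝ → ℝ be three times continuously differentiable functions of (t,x) with H̄_s + H_s > 0 and H̄_b + H_b > 0 everywhere, satisfying pointwise the bilayer shallow water system with thickness diffusivity: ∂_t H_s + ∂_x((H̄_s + H_s)(Ū_s + U_s)) = κ·∂_x²H_s, ∂_t H_b + ∂_x((H̄_b + H_b)(Ū_b + U_b)) = κ·∂_x²H_b, ∂_t U_s + (Ū_s + U_s − κ·∂_xH_s/(H̄_s + H_s))·∂_x U_s + ∂_x H_s + ∂_x H_b = 0, ∂_t U_b + (Ū_b + U_b − κ·∂_xH_b/(H̄_b + H_b))·∂_x U_b + (ρ_s/ρ_b)·∂_x H_s + ∂_x H_b = 0. Define the total velocities V_s = U_s − κ·∂_xH_s/(H̄_s + H_s) and V_b = U_b − κ·∂_xH_b/(H̄_b + H_b). Then pointwise: ∂_t H_s + ∂_x((H̄_s + H_s)(Ū_s + V_s)) = 0, ∂_t H_b + ∂_x((H̄_b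 + H_b)(Ū_b + V_b)) = 0, ∂_t V_s + (Ū_s + V_s − κ·∂_xH_s/(H̄_s + H_s))·∂_x V_s + ∂_x H_s + ∂_x H_b = κ·∂_x²V_s, and ∂_t V_b + (Ū_b + V_b − κ·∂_xH_b/(H̄_b + H_b))·∂_x V_b + (ρ_s/ρ_b)·∂_x H_s + ∂_x H_b = κ·∂_x²V_b. -/
section PartialDerivatives

variable {f : ℝ → ℝ → ℝ}

theorem hasDerivAt_fst_of_differentiable
    (hf : Differentiable ℝ (fun p : ℝ × ℝ => f p.1 p.2)) (t x : ℝ) :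
    HasDerivAt (fun t' => f t' x) (fderiv ℝ (fun p : ℝ × ℝ => f p.1 p.2) (t, x) (1, 0)) t :=
  (hf (t, x)).hasFDerivAt.comp_hasDerivAt (f := fun t' : ℝ => (t', x)) t
    ((hasDerivAt_id t).prodMk (hasDerivAt_const t x))

theorem hasDerivAt_snd_of_differentiable
    (hf : Differentiable ℝ (fun p : ℝ × ℝ => f p.1 p.2)) (t x : ℝ) :
    HasDerivAt (fun x' => f t x') (fderiv ℝ (fun p : ℝ × ℝ => f p.1 p.2) (t, x) (0, 1)) x :=
  (hf (t, x)).hasFDerivAt.comp_hasDerivAt (f := fun x' : ℝ => (t, x')) x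
    ((hasDerivAt_const x t).prodMk (hasDerivAt_id x))

theorem ContDiff.deriv_fst {m n : WithTop ℕ∞}
    (hf : ContDiff ℝ n (fun p : ℝ × ℝ => f p.1 p.2)) (hmn : m + 1 ≤ n) :
    ContDiff ℝ m (fun p : ℝ × ℝ => deriv (fun t' => f t' p.2) p.1) := by
  have hd : Differentiable ℝ (fun p : ℝ × ℝ => f p.1 p.2) :=
    (hf.of_le (le_trans le_add_self hmn)).differentiable one_ne_zero
  simp only [fun p : ℝ × ℝ => (hasDerivAt_fst_of_differentiable hd p.1 p.2).deriv]
  exact (hf.fderiv_right hmn).clm_apply contDiff_const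

theorem ContDiff.deriv_snd {m n : WithTop ℕ∞}
    (hf : ContDiff ℝ n (fun p : ℝ × ℝ => f p.1 p.2)) (hmn : m + 1 ≤ n) :
    ContDiff ℝ m (fun p : ℝ × ℝ => deriv (fun x' => f p.1 x') p.2) := by
  have hd : Differentiable ℝ (fun p : ℝ × ℝ => f p.1 p.2) :=
    (hf.of_le (le_trans le_add_self hmn)).differentiable one_ne_zero
  simp only [fun p : ℝ × ℝ => (hasDerivAt_snd_of_differentiable hd p.1 p.2).deriv]
  exact (hf.fderiv_right hmn).clm_apply contDiff_const

theorem ContDiff.deriv_fst_deriv_snd_comm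
    (hf : ContDiff ℝ 2 (fun p : ℝ × ℝ => f p.1 p.2)) (t x : ℝ) :
    deriv (fun t' => deriv (fun x' => f t' x') x) t
      = deriv (fun x' => deriv (fun t' => f t' x') t) x := by
  have hd : Differentiable ℝ (fun p : ℝ × ℝ => f p.1 p.2) := hf.differentiable two_ne_zero
  have hd' : Differentiable ℝ (fderiv ℝ (fun p : ℝ × ℝ => f p.1 p.2)) :=
    (hf.fderiv_right (m := 1) (by norm_num)).differentiable one_ne_zero
  simp only [fun s y => (hasDerivAt_fst_of_differentiable hd s y).deriv,
    fun s y => (hasDerivAt_snd_of_differentiable hd s y).deriv]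
  have h₁ := ((hd' (t, x)).hasFDerivAt.comp_hasDerivAt (f := fun t' : ℝ => (t', x)) t
    ((hasDerivAt_id t).prodMk (hasDerivAt_const t x))).clm_apply
      (hasDerivAt_const t ((0, 1) : ℝ × ℝ))
  have h₂ := ((hd' (t, x)).hasFDerivAt.comp_hasDerivAt (f := fun x' : ℝ => (t, x')) x
    ((hasDerivAt_const x t).prodMk (hasDerivAt_id x))).clm_apply
      (hasDerivAt_const x ((1, 0) : ℝ × ℝ))
  have hsymm : IsSymmSndFDerivAt ℝ (fun p : ℝ × ℝ => f p.1 p.2) (t, x) :=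
    hf.contDiffAt.isSymmSndFDerivAt (by simp)
  refine h₁.deriv.trans (Eq.trans ?_ h₂.deriv.symm)
  simpa using hsymm (1, 0) (0, 1)

end PartialDerivatives

/-- The two-velocity reformulation for a single layer, where `P` collects the pressure terms. -/
theorem layer_two_velocity_reformulation {κ Ubar Hbar : ℝ} {H U V P : ℝ → ℝ → ℝ}
    (hregH : ContDiff ℝ 3 (fun p : ℝ × ℝ => H p.1 p.2))
    (hregU : ContDiff ℝ 2 (fun p : ℝ × ℝ => U p.1 p.2))
    (hne : ∀ t x : ℝ, Hbar + H t x ≠ 0)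
    (heqH : ∀ t x : ℝ,
      deriv (fun t' => H t' x) t
        + deriv (fun x' => (Hbar + H t x') * (Ubar + U t x')) x
      = κ * deriv (fun x' => deriv (fun y => H t y) x') x)
    (heqU : ∀ t x : ℝ,
      deriv (fun t' => U t' x) t
        + (Ubar + U t x - κ * deriv (fun x' => H t x') x / (Hbar + H t x))
            * deriv (fun x' => U t x') x
        + P t x = 0)
    (hV : ∀ t x : ℝ, V t x = U t x - κ * deriv (fun x' => H t x') x / (Hbar + H t x))
    (t x : ℝ) :
    (deriv (fun t' => H t' x) t
        + deriv (fun x' => (Hbar + H t x') * (Ubar + V t x')) x = 0)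
      ∧
      (deriv (fun t' => V t' x) t
        + (Ubar + V t x - κ * deriv (fun x' => H t x') x / (Hbar + H t x))
            * deriv (fun x' => V t x') x
        + P t x
      = κ * deriv (fun x' => deriv (fun y => V t y) x') x) := by
  obtain rfl : V = fun t x => U t x - κ * deriv (fun x' => H t x') x / (Hbar + H t x) :=
    funext₂ hV
  have hasDeriv_t {f : ℝ → ℝ → ℝ} (hf : ContDiff ℝ 1 (fun p : ℝ × ℝ => f p.1 p.2)) (s y : ℝ) :
      HasDerivAt (fun t' => f t' y) (deriv (fun t' => f t' y) s) s :=
    (hasDerivAt_fst_of_differentiable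
      (hf.differentiable one_ne_zero) s y).differentiableAt.hasDerivAt
  have hasDeriv_x {f : ℝ → ℝ → ℝ} (hf : ContDiff ℝ 1 (fun p : ℝ × ℝ => f p.1 p.2)) (s y : ℝ) :
      HasDerivAt (fun x' => f s x') (deriv (fun x' => f s x') y) y :=
    (hasDerivAt_snd_of_differentiable
      (hf.differentiable one_ne_zero) s y).differentiableAt.hasDerivAt
  have hregHx : ContDiff ℝ 2 (fun p : ℝ × ℝ => deriv (fun x' => H p.1 x') p.2) :=
    hregH.deriv_snd (by norm_num)
  have hregHxx : ContDiff ℝ 1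
      (fun p : ℝ × ℝ => deriv (fun y => deriv (fun x' => H p.1 x') y) p.2) :=
    hregHx.deriv_snd (f := fun s y => deriv (fun x' => H s x') y) (by norm_num)
  have hregUx : ContDiff ℝ 1 (fun p : ℝ × ℝ => deriv (fun x' => U p.1 x') p.2) :=
    hregU.deriv_snd (by norm_num)
  have hmixed := (hregH.of_le (by norm_num)).deriv_fst_deriv_snd_comm t x
  have hHt := hasDeriv_t (hregH.of_le (by norm_num))
  have hHx := hasDeriv_x (hregH.of_le (by norm_num))
  have hUt := hasDeriv_t (hregU.of_le (by norm_num))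
  have hUx := hasDeriv_x (hregU.of_le (by norm_num))
  have hHxt := hasDeriv_t (f := fun s y => deriv (fun x' => H s x') y)
    (hregHx.of_le (by norm_num))
  have hHxx := hasDeriv_x (f := fun s y => deriv (fun x' => H s x') y)
    (hregHx.of_le (by norm_num))
  have hHxxx := hasDeriv_x
    (f := fun s y => deriv (fun z => deriv (fun x' => H s x') z) y) hregHxx
  have hUxx := hasDeriv_x (f := fun s y => deriv (fun x' => U s x') y) hregUx
  have hVx (y : ℝ) := (hUx t y).sub
    (((hHxx t y).const_mul κ).div ((hHx t y).const_add Hbar) (hne t y))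
  have hVt := (hUt t x).sub
    (((hHxt t x).const_mul κ).div ((hHt t x).const_add Hbar) (hne t x))
  have hVxx := (hUxx t x).sub
    (((((hHxxx t x).const_mul κ).mul ((hHx t x).const_add Hbar)).sub
      (((hHxx t x).const_mul κ).mul (hHxx t x))).div
      (((hHx t x).const_add Hbar).pow 2) (pow_ne_zero 2 (hne t x)))
  have hmass (y : ℝ) : deriv (fun t' => H t' y) t
      = κ * deriv (fun x' => deriv (fun z => H t z) x') y
        - (deriv (fun x' => H t x') y * (Ubar + U t y)
          + (Hbar + H t y) * deriv (fun x' => U t x') y) := by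
    have h := heqH t y
    have hflux := (((hHx t y).const_add Hbar).mul ((hUx t y).const_add Ubar)).deriv
    linear_combination h - hflux
  have hHtx := (((hHxxx t x).const_mul κ).sub
    (((hHxx t x).mul ((hUx t x).const_add Ubar)).add
      (((hHx t x).const_add Hbar).mul (hUxx t x)))).deriv
  have hHtx' := (congrArg (fun g => deriv g x) (funext hmass)).trans hHtx
  have eVx := fun y => (hVx y).deriv
  have eVt := hVt.deriv
  have eVxx := (congrArg (fun g => deriv g x) (funext eVx)).trans hVxx.deriv
  have eflux := (((hHx t x).const_add Hbar).mul ((hVx x).const_add Ubar)).deriv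
  have hm := hmass x
  have hu := heqU t x
  have hx := hne t x
  have eVx' := eVx x
  constructor
  · refine (congrArg₂ (· + ·) hm eflux).trans ?_
    simp only [Pi.sub_apply, Pi.div_apply]
    field_simp
    ring
  · refine (congrArg₂ (· + ·) (congrArg₂ (· + ·) eVt (congrArg₂ (· * ·) rfl eVx')) rfl).trans
      (Eq.trans ?_ (congrArg (κ * ·) eVxx).symm)
    rw [hmixed, hHtx', hm, eq_neg_of_add_eq_zero_right hu]
    simp only [Pi.sub_apply, Pi.mul_apply, Pi.pow_apply]
    field_simp
    ring

/-- Two-velocity (BD-entropy type) reformulation of the bilayer shallow water system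
with thickness diffusivity `κ > 0`: if `(H_s, H_b, U_s, U_b)` is a `C³` solution of
the bilayer system and `V_ℓ = U_ℓ - κ ∂_x H_ℓ/(H̄_ℓ + H_ℓ)` are the total velocities,
then the mass equations become non-diffusive transport equations and the diffusion
appears as an effective viscosity in the equations for `V_s, V_b`. -/
theorem bilayer_two_velocity_reformulation
    (κ ρs ρb Ubars Ubarb Hbars Hbarb : ℝ)
    (hκ : 0 < κ) (hρs : 0 < ρs) (hρb : 0 < ρb)
    (hHbars : 0 < Hbars) (hHbarb : 0 < Hbarb)
    (Hs Hb Us Ub : ℝ → ℝ → ℝ)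
    (hregHs : ContDiff ℝ 3 (fun p : ℝ × ℝ => Hs p.1 p.2))
    (hregHb : ContDiff ℝ 3 (fun p : ℝ × ℝ => Hb p.1 p.2))
    (hregUs : ContDiff ℝ 3 (fun p : ℝ × ℝ => Us p.1 p.2))
    (hregUb : ContDiff ℝ 3 (fun p : ℝ × ℝ => Ub p.1 p.2))
    (hposs : ∀ t x : ℝ, 0 < Hbars + Hs t x)
    (hposb : ∀ t x : ℝ, 0 < Hbarb + Hb t x)
    -- the bilayer shallow water system with thickness diffusivity
    (heqHs : ∀ t x : ℝ,
      deriv (fun t' => Hs t' x) t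
        + deriv (fun x' => (Hbars + Hs t x') * (Ubars + Us t x')) x
      = κ * deriv (fun x' => deriv (fun y => Hs t y) x') x)
    (heqHb : ∀ t x : ℝ,
      deriv (fun t' => Hb t' x) t
        + deriv (fun x' => (Hbarb + Hb t x') * (Ubarb + Ub t x')) x
      = κ * deriv (fun x' => deriv (fun y => Hb t y) x') x)
    (heqUs : ∀ t x : ℝ,
      deriv (fun t' => Us t' x) t
        + (Ubars + Us t x - κ * deriv (fun x' => Hs t x') x / (Hbars + Hs t x))
            * deriv (fun x' => Us t x') x
        + deriv (fun x' => Hs t x') x + deriv (fun x' => Hb t x') x = 0)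
    (heqUb : ∀ t x : ℝ,
      deriv (fun t' => Ub t' x) t
        + (Ubarb + Ub t x - κ * deriv (fun x' => Hb t x') x / (Hbarb + Hb t x))
            * deriv (fun x' => Ub t x') x
        + (ρs / ρb) * deriv (fun x' => Hs t x') x + deriv (fun x' => Hb t x') x = 0)
    -- the total velocities
    (Vs Vb : ℝ → ℝ → ℝ)
    (hVs : ∀ t x : ℝ,
      Vs t x = Us t x - κ * deriv (fun x' => Hs t x') x / (Hbars + Hs t x))
    (hVb : ∀ t x : ℝ,
      Vb t x = Ub t x - κ * deriv (fun x' => Hb t x') x / (Hbarb + Hb t x)) :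
    ∀ t x : ℝ,
      (deriv (fun t' => Hs t' x) t
        + deriv (fun x' => (Hbars + Hs t x') * (Ubars + Vs t x')) x = 0)
      ∧
      (deriv (fun t' => Hb t' x) t
        + deriv (fun x' => (Hbarb + Hb t x') * (Ubarb + Vb t x')) x = 0)
      ∧
      (deriv (fun t' => Vs t' x) t
        + (Ubars + Vs t x - κ * deriv (fun x' => Hs t x') x / (Hbars + Hs t x))
            * deriv (fun x' => Vs t x') x
        + deriv (fun x' => Hs t x') x + deriv (fun x' => Hb t x') x
      = κ * deriv (fun x' => deriv (fun y => Vs t y) x') x)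
      ∧
      (deriv (fun t' => Vb t' x) t
        + (Ubarb + Vb t x - κ * deriv (fun x' => Hb t x') x / (Hbarb + Hb t x))
            * deriv (fun x' => Vb t x') x
        + (ρs / ρb) * deriv (fun x' => Hs t x') x + deriv (fun x' => Hb t x') x
      = κ * deriv (fun x' => deriv (fun y => Vb t y) x') x) := by
  have hs := layer_two_velocity_reformulation
    (P := fun t x => deriv (fun x' => Hs t x') x + deriv (fun x' => Hb t x') x)
    hregHs (hregUs.of_le (by norm_num)) (fun t x => (hposs t x).ne') heqHs
    (fun t x => by rw [← add_assoc]; exact heqUs t x) hVs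
  have hb := layer_two_velocity_reformulation
    (P := fun t x => (ρs / ρb) * deriv (fun x' => Hs t x') x + deriv (fun x' => Hb t x') x)
    hregHb (hregUb.of_le (by norm_num)) (fun t x => (hposb t x).ne') heqHb
    (fun t x => by rw [← add_assoc]; exact heqUb t x) hVb
  simp only [← add_assoc] at hs hb
  exact fun t x => ⟨(hs t x).1, (hb t x).1, (hs t x).2, (hb t x).2⟩
end
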